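/- arXiv:1907.09047 — 14 statements merged into one kernel-verified Lean document; each statement's English description precedes it below -/
import Mathlib

section
/- Let n ≥ 1, let F be a field, and let P, Q ∈ Pos(n) with T_P ⊆ T_Q. Suppose P is complemented in Q, i.e. there exists R ∈ Pos(n) with T_R = T_Q \ T_P. Then the map sending a matrix A ∈ U(R;F) to its left coset A·I*(P;F) is a bijection from U(R;F) onto the left-coset space I*(Q;F)/I*(P;F). -/
open scoped Classical in
/-- The matrix, computed along increasing `j - i`, whose entries are those of the `P`-factor of `B`
and, up to scaling columns by the diagonal of `B`, those of the `R`-factor. -/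
noncomputable def incidenceFactor {n : ℕ} {F : Type*} [Field F]
    (leP leR : Fin n → Fin n → Prop) (B : Matrix (Fin n) (Fin n) F) (i j : Fin n) : F :=
  B i j - ∑ k ∈ (Finset.Ioo i j).attach,
    (if leR i k then incidenceFactor leP leR B i k / B k k else 0) *
      (if leP k j then incidenceFactor leP leR B k j else 0)
termination_by (j : ℕ) - i
decreasing_by
  all_goals
    have hk := Finset.mem_Ioo.1 k.2
    simp only [Fin.lt_def] at hk
    omega

theorem Matrix.mul_apply_of_upper_of_lt {n : ℕ} {F : Type*} [Field F]
    {A X : Matrix (Fin n) (Fin n) F} (hA : ∀ i j, j < i → A i j = 0)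
    (hX : ∀ i j, j < i → X i j = 0) {i j : Fin n} (hij : i < j) :
    (A * X) i j = A i i * X i j + (A i j * X j j + ∑ k ∈ Finset.Ioo i j, A i k * X k j) := by
  have h : Finset.Icc i j = insert i (insert j (Finset.Ioo i j)) := by
    ext k
    simp only [Finset.mem_Icc, Finset.mem_insert, Finset.mem_Ioo]
    omega
  rw [Matrix.mul_apply, ← Finset.sum_subset (Finset.subset_univ (Finset.Icc i j)), h,
    Finset.sum_insert (by simp [hij.ne]), Finset.sum_insert (by simp)]
  intro k _ hk
  rw [Finset.mem_Icc, not_and_or, not_le, not_le] at hk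
  rcases hk with hk | hk
  · rw [hA _ _ hk, zero_mul]
  · rw [hX _ _ hk, mul_zero]

theorem Matrix.mul_apply_self_of_upper {n : ℕ} {F : Type*} [Field F]
    {A X : Matrix (Fin n) (Fin n) F} (hA : ∀ i j, j < i → A i j = 0)
    (hX : ∀ i j, j < i → X i j = 0) (i : Fin n) :
    (A * X) i i = A i i * X i i := by
  rw [Matrix.mul_apply, Finset.sum_eq_single i]
  · intro k _ hk
    rcases lt_or_gt_of_ne hk with hk | hk
    · rw [hA _ _ hk, zero_mul]
    · rw [hX _ _ hk, mul_zero]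
  · simp

/-- A factorization into a unitriangular and a triangular matrix, supported on relations that do not
meet off the diagonal, is unique. -/
theorem Matrix.eq_of_mul_eq_mul_of_disjoint_support {n : ℕ} {F : Type*} [Field F]
    {leP leR : Fin n → Fin n → Prop} (hP : ∀ i j, leP i j → i ≤ j) (hR : ∀ i j, leR i j → i ≤ j)
    (hdisj : ∀ i j, i ≠ j → leR i j → ¬ leP i j)
    {A X A' X' : Matrix (Fin n) (Fin n) F}
    (hA : ∀ i j, ¬ leR i j → A i j = 0) (hA1 : ∀ i, A i i = 1)
    (hA' : ∀ i j, ¬ leR i j → A' i j = 0) (hA1' : ∀ i, A' i i = 1)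
    (hX : ∀ i j, ¬ leP i j → X i j = 0) (hX' : ∀ i j, ¬ leP i j → X' i j = 0)
    (hX0 : ∀ i, X i i ≠ 0) (h : A * X = A' * X') : A = A' := by
  have uA : ∀ i j, j < i → A i j = 0 := fun i j hij => hA i j fun h => (hR i j h).not_gt hij
  have uA' : ∀ i j, j < i → A' i j = 0 := fun i j hij => hA' i j fun h => (hR i j h).not_gt hij
  have uX : ∀ i j, j < i → X i j = 0 := fun i j hij => hX i j fun h => (hP i j h).not_gt hij
  have uX' : ∀ i j, j < i → X' i j = 0 := fun i j hij => hX' i j fun h => (hP i j h).not_gt hij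
  have hd : ∀ i, X i i = X' i i := by
    intro i
    have := congrFun (congrFun h i) i
    rwa [mul_apply_self_of_upper uA uX, mul_apply_self_of_upper uA' uX', hA1, hA1', one_mul,
      one_mul] at this
  have key : ∀ d : ℕ, ∀ i j : Fin n, (j : ℕ) - i = d → i < j → A i j = A' i j ∧ X i j = X' i j := by
    intro d
    induction d using Nat.strong_induction_on with
    | _ d ih =>
      intro i j hd' hij
      have e := congrFun (congrFun h i) j
      have hs : ∑ k ∈ Finset.Ioo i j, A i k * X k j = ∑ k ∈ Finset.Ioo i j, A' i k * X' k j := by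
        refine Finset.sum_congr rfl fun k hk => ?_
        obtain ⟨h1, h2⟩ := Finset.mem_Ioo.1 hk
        have h1' := Fin.lt_def.1 h1
        have h2' := Fin.lt_def.1 h2
        rw [(ih (k - i) (by omega) i k rfl h1).1, (ih (j - k) (by omega) k j rfl h2).2]
      rw [mul_apply_of_upper_of_lt uA uX hij, mul_apply_of_upper_of_lt uA' uX' hij, hs, hA1, hA1',
        one_mul, one_mul, ← add_assoc, ← add_assoc, add_left_inj, ← hd] at e
      by_cases hr : leR i j
      · have hp := hdisj i j hij.ne hr
        rw [hX _ _ hp, hX' _ _ hp, zero_add, zero_add] at e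
        exact ⟨mul_right_cancel₀ (hX0 j) e, by rw [hX _ _ hp, hX' _ _ hp]⟩
      · rw [hA _ _ hr, hA' _ _ hr, zero_mul, add_zero, add_zero] at e
        exact ⟨by rw [hA _ _ hr, hA' _ _ hr], e⟩
  ext i j
  rcases lt_trichotomy i j with hij | rfl | hij
  · exact (key _ i j rfl hij).1
  · rw [hA1, hA1']
  · rw [uA _ _ hij, uA' _ _ hij]

/-- A triangular matrix supported on `Q` factors as a unitriangular matrix supported on `R` times
a triangular matrix supported on `P`, when `Q` is the union of `P` and `R`. -/
theorem Matrix.exists_eq_mul_of_support_union {n : ℕ} {F : Type*} [Field F]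
    {leP leQ leR : Fin n → Fin n → Prop} (hPrefl : ∀ i, leP i i)
    (hPnat : ∀ i j, leP i j → i ≤ j) (hRnat : ∀ i j, leR i j → i ≤ j) (hRrefl : ∀ i, leR i i)
    (hQtrans : ∀ i j k, leQ i j → leQ j k → leQ i k)
    (hPQ : ∀ i j, i ≠ j → leP i j → leQ i j)
    (hcompl : ∀ i j, i ≠ j → (leR i j ↔ (leQ i j ∧ ¬ leP i j)))
    {B : Matrix (Fin n) (Fin n) F} (hB : ∀ i j, ¬ leQ i j → B i j = 0)
    (uB : ∀ i j, j < i → B i j = 0) (hB0 : ∀ i, B i i ≠ 0) :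
    ∃ A X : Matrix (Fin n) (Fin n) F, (∀ i j, ¬ leR i j → A i j = 0) ∧ (∀ i, A i i = 1) ∧
      (∀ i j, ¬ leP i j → X i j = 0) ∧ B = A * X := by
  classical
  let M := incidenceFactor leP leR B
  let A : Matrix (Fin n) (Fin n) F := fun i j => if leR i j then M i j / B j j else 0
  let X : Matrix (Fin n) (Fin n) F := fun i j => if leP i j then M i j else 0
  have hM : ∀ i j, M i j = B i j - ∑ k ∈ Finset.Ioo i j, A i k * X k j := by
    intro i j
    rw [← Finset.sum_attach]
    simp only [M, A, X]
    rw [incidenceFactor]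
  have hMd : ∀ i, M i i = B i i := by simp [hM]
  have hA : ∀ i j, ¬ leR i j → A i j = 0 := fun i j h => if_neg h
  have hX : ∀ i j, ¬ leP i j → X i j = 0 := fun i j h => if_neg h
  have hA1 : ∀ i, A i i = 1 := by
    intro i
    simp only [A, if_pos (hRrefl i), hMd]
    exact div_self (hB0 i)
  have hXd : ∀ i, X i i = B i i := by
    intro i
    simp only [X, if_pos (hPrefl i), hMd]
  have uA : ∀ i j, j < i → A i j = 0 := fun i j hij => hA i j fun h => (hRnat i j h).not_gt hij
  have uX : ∀ i j, j < i → X i j = 0 := fun i j hij => hX i j fun h => (hPnat i j h).not_gt hij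
  refine ⟨A, X, hA, hA1, hX, ?_⟩
  ext i j
  rcases lt_trichotomy i j with hij | rfl | hij
  · rw [mul_apply_of_upper_of_lt uA uX hij, hA1, one_mul, hXd, ← add_assoc, ← sub_eq_iff_eq_add,
      ← hM]
    have hc := hcompl i j hij.ne
    by_cases hp : leP i j
    · have hr : ¬ leR i j := fun h => (hc.1 h).2 hp
      simp [A, X, hp, hr]
    · by_cases hr : leR i j
      · simp [A, X, hp, hr, hB0 j]
      · have hq : ¬ leQ i j := fun h => hr (hc.2 ⟨h, hp⟩)
        rw [hA _ _ hr, hX _ _ hp, zero_mul, add_zero, hM, hB _ _ hq, zero_sub, neg_eq_zero]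
        refine Finset.sum_eq_zero fun k hk => ?_
        obtain ⟨h1, h2⟩ := Finset.mem_Ioo.1 hk
        by_cases hr' : leR i k
        · by_cases hp' : leP k j
          · exact absurd (hQtrans _ _ _ ((hcompl i k h1.ne).1 hr').1 (hPQ k j h2.ne hp')) hq
          · rw [hX _ _ hp', mul_zero]
        · rw [hA _ _ hr', zero_mul]
  · rw [mul_apply_self_of_upper uA uX, hA1, one_mul, hXd]
  · have uAX : (A * X).BlockTriangular id :=
      Matrix.BlockTriangular.mul (fun i j h => uA i j h) (fun i j h => uX i j h)
    rw [uB _ _ hij, uAX hij]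

theorem Matrix.GeneralLinearGroup.apply_self_ne_zero_of_upper {n : ℕ} {F : Type*} [Field F]
    (B : Matrix.GeneralLinearGroup (Fin n) F)
    (hB : ∀ i j, j < i → (B : Matrix (Fin n) (Fin n) F) i j = 0) (i : Fin n) :
    (B : Matrix (Fin n) (Fin n) F) i i ≠ 0 := by
  have hdet : (B : Matrix (Fin n) (Fin n) F).det ≠ 0 := B.det_ne_zero
  rw [Matrix.det_of_isUpperTriangular (fun i j h => hB i j h), Finset.prod_ne_zero_iff] at hdet
  exact hdet i (Finset.mem_univ i)

/-- If `P` is complemented in `Q` (witnessed by `R` with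
`T_R = T_Q \ T_P`), then the coset map `A ↦ A · I*(P;F)` is a bijection from
`U(R;F)` onto the left-coset space `I*(Q;F)/I*(P;F)`: every element `B` of
`I*(Q;F)` lies in the coset of a unique `A ∈ U(R;F)`. -/
theorem stmt_0 (n : ℕ) (hn : 1 ≤ n) (F : Type*) [Field F]
    (leP leQ leR : Fin n → Fin n → Prop)
    (hPrefl : ∀ i, leP i i) (hPtrans : ∀ i j k, leP i j → leP j k → leP i k)
    (hPnat : ∀ i j, leP i j → i ≤ j)
    (hQrefl : ∀ i, leQ i i) (hQtrans : ∀ i j k, leQ i j → leQ j k → leQ i k)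
    (hQnat : ∀ i j, leQ i j → i ≤ j)
    (hRrefl : ∀ i, leR i i) (hRtrans : ∀ i j k, leR i j → leR j k → leR i k)
    (hRnat : ∀ i j, leR i j → i ≤ j)
    (hPQ : ∀ i j, i ≠ j → leP i j → leQ i j)
    (hcompl : ∀ i j, i ≠ j → (leR i j ↔ (leQ i j ∧ ¬ leP i j)))
    (B : Matrix.GeneralLinearGroup (Fin n) F)
    (hB : ∀ i j, ¬ leQ i j → (B : Matrix (Fin n) (Fin n) F) i j = 0) :
    ∃! A : Matrix.GeneralLinearGroup (Fin n) F,
      ((∀ i j, ¬ leR i j → (A : Matrix (Fin n) (Fin n) F) i j = 0) ∧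
        (∀ i, (A : Matrix (Fin n) (Fin n) F) i i = 1)) ∧
      ∃ X : Matrix.GeneralLinearGroup (Fin n) F,
        (∀ i j, ¬ leP i j → (X : Matrix (Fin n) (Fin n) F) i j = 0) ∧ B = A * X := by
  have uB : ∀ i j, j < i → (B : Matrix (Fin n) (Fin n) F) i j = 0 :=
    fun i j hij => hB i j fun h => (hQnat i j h).not_gt hij
  obtain ⟨A, X, hA, hA1, hX, hBAX⟩ := Matrix.exists_eq_mul_of_support_union hPrefl hPnat hRnat
    hRrefl hQtrans hPQ hcompl hB uB (B.apply_self_ne_zero_of_upper uB)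
  have hdet : A.det * X.det ≠ 0 := by
    rw [← Matrix.det_mul, ← hBAX]
    exact B.det_ne_zero
  refine ⟨Matrix.GeneralLinearGroup.mkOfDetNeZero A (left_ne_zero_of_mul hdet), ⟨⟨hA, hA1⟩,
    Matrix.GeneralLinearGroup.mkOfDetNeZero X (right_ne_zero_of_mul hdet), hX,
    Units.ext hBAX⟩, ?_⟩
  rintro A' ⟨⟨hA', hA1'⟩, X', hX', hBAX'⟩
  have hX0' : ∀ i, (X' : Matrix (Fin n) (Fin n) F) i i ≠ 0 :=
    X'.apply_self_ne_zero_of_upper fun i j hij => hX' i j fun h => (hPnat i j h).not_gt hij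
  refine Units.ext (Matrix.eq_of_mul_eq_mul_of_disjoint_support hPnat hRnat
    (fun i j hij hr => ((hcompl i j hij).1 hr).2) hA' hA1' hA hA1 hX' hX hX0' ?_)
  rw [← Units.val_mul, ← hBAX']
  exact hBAX
end

section
/- Let n ≥ 1, F a field, P ∈ Pos(n), and let A be an invertible n×n matrix over F. Then A maps the subspace span{e_j : j ≤_P i} of F^n onto itself for every i ∈ Fin n if and only if A i j = 0 whenever ¬(i ≤_P j). In other words, the isotropy group in GL(n,F) of the standard P-flag (span{e_j : j ≤_P 1}, …, span{e_j : j ≤_P n}) is exactly the incidence group I*(P;F). -/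
/-- The coordinate subspace spanned by the standard basis vectors indexed by `s` consists of the
vectors vanishing outside `s`. -/
theorem mem_span_single_image_iff {ι F : Type*} [Fintype ι] [DecidableEq ι] [Semiring F]
    (s : Set ι) (v : ι → F) :
    v ∈ Submodule.span F ((fun j : ι => (Pi.single j (1 : F) : ι → F)) '' s) ↔
      ∀ k, k ∉ s → v k = 0 := by
  constructor
  · intro h k hk
    induction h using Submodule.span_induction with
    | mem x hx =>
      obtain ⟨j, hj, rfl⟩ := hx
      exact Pi.single_eq_of_ne (ne_of_mem_of_not_mem hj hk).symm _
    | zero => rfl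
    | add x y _ _ hx hy => simp [hx, hy]
    | smul a x _ hx => simp [hx]
  · intro h
    rw [pi_eq_sum_univ' v]
    refine Submodule.sum_mem _ fun k _ => ?_
    by_cases hk : k ∈ s
    · exact Submodule.smul_mem _ _ (Submodule.subset_span ⟨k, hk, by ext; simp [Pi.single_apply]⟩)
    · simp [h k hk]


/-- An invertible matrix `A` maps each subspace
`span{e_j : j ≤_P i}` of `F^n` onto itself iff `A i j = 0` whenever
`¬(i ≤_P j)`; i.e. the isotropy group of the standard `P`-flag in `GL(n,F)`
is the incidence group `I*(P;F)`. -/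
theorem stmt_1 (n : ℕ) (hn : 1 ≤ n) (F : Type*) [Field F]
    (leP : Fin n → Fin n → Prop)
    (hPrefl : ∀ i, leP i i) (hPtrans : ∀ i j k, leP i j → leP j k → leP i k)
    (hPnat : ∀ i j, leP i j → i ≤ j)
    (A : Matrix.GeneralLinearGroup (Fin n) F) :
    (∀ i : Fin n,
        Submodule.map ((A : Matrix (Fin n) (Fin n) F).mulVecLin)
          (Submodule.span F ((fun j : Fin n => Pi.single j (1 : F)) '' {j | leP j i}))
          = Submodule.span F ((fun j : Fin n => Pi.single j (1 : F)) '' {j | leP j i}))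
      ↔ (∀ i j, ¬ leP i j → (A : Matrix (Fin n) (Fin n) F) i j = 0) := by
  constructor
  · intro h i j hij
    have hmem := (h j).le (Submodule.mem_map_of_mem
      (Submodule.subset_span (Set.mem_image_of_mem _ (hPrefl j))))
    rw [mem_span_single_image_iff] at hmem
    simpa using hmem i hij
  · intro h i
    have hinj : Function.Injective (A : Matrix (Fin n) (Fin n) F).mulVecLin :=
      Matrix.mulVec_injective_of_isUnit A.isUnit
    refine Submodule.eq_of_le_of_finrank_eq ?_
      (LinearEquiv.finrank_eq (Submodule.equivMapOfInjective _ hinj _)).symm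
    rw [Submodule.map_span_le]
    rintro _ ⟨j, hj, rfl⟩
    rw [mem_span_single_image_iff]
    intro k hk
    simpa using h k j fun hkj => hk (hPtrans k j i hkj hj)
end

section
/- Let n ≥ 1, let F_q be a finite field with q elements, and let P ∈ Pos(n). Then the number of left cosets of the subgroup I*(P;F_q) in GL(n,F_q) equals q^{n(n−1)/2 − |T_P|} · ∏_{k=1}^{n} [k]_q, where [k]_q = 1 + q + ⋯ + q^{k−1}. (Note |T_P| ≤ n(n−1)/2.) -/
/-- The incidence group of a reflexive and transitive relation over a finite field. -/
def incidenceSubgroup {n : ℕ} (F : Type*) [Field F] [Finite F] (r : Fin n → Fin n → Prop)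
    (hrefl : ∀ i, r i i) (htrans : ∀ i j k, r i j → r j k → r i k) :
    Subgroup (Matrix.GeneralLinearGroup (Fin n) F) :=
  let M : Submonoid (Matrix.GeneralLinearGroup (Fin n) F) :=
    { carrier := {X | ∀ i j, ¬ r i j → (X : Matrix (Fin n) (Fin n) F) i j = 0}
      one_mem' := fun i j h => by
        have hij : i ≠ j := fun e => h (e ▸ hrefl i)
        simp [hij]
      mul_mem' := fun {X Y} hX hY i j h => by
        simp only [Matrix.GeneralLinearGroup.coe_mul, Matrix.mul_apply]
        refine Finset.sum_eq_zero fun k _ => ?_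
        by_cases hik : r i k
        · rw [hY k j fun hkj => h (htrans i k j hik hkj), mul_zero]
        · rw [hX i k hik, zero_mul] }
  { M with
    inv_mem' := fun {X} hX => by
      have : X⁻¹ = X ^ (orderOf X - 1) := by
        rw [inv_eq_iff_mul_eq_one, ← pow_succ', Nat.sub_add_cancel (orderOf_pos X),
          pow_orderOf_eq_one]
      rw [this]
      exact M.pow_mem hX _ }

theorem mem_incidenceSubgroup {n : ℕ} {F : Type*} [Field F] [Finite F]
    {r : Fin n → Fin n → Prop} {hrefl : ∀ i, r i i}
    {htrans : ∀ i j k, r i j → r j k → r i k} {X : Matrix.GeneralLinearGroup (Fin n) F} :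
    X ∈ incidenceSubgroup F r hrefl htrans ↔
      ∀ i j, ¬ r i j → (X : Matrix (Fin n) (Fin n) F) i j = 0 :=
  Iff.rfl

theorem det_eq_prod_diag_of_incidence {n : ℕ} {F : Type*} [Field F]
    {r : Fin n → Fin n → Prop} (hle : ∀ i j, r i j → i ≤ j)
    {A : Matrix (Fin n) (Fin n) F} (hA : ∀ i j, ¬ r i j → A i j = 0) :
    A.det = ∏ i, A i i :=
  Matrix.det_of_isUpperTriangular fun i j hji => hA i j fun h => (hle i j h).not_gt hji

open Classical in
/-- The matrix with prescribed diagonal and prescribed entries at the strict relations of `r`. -/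
noncomputable def incidenceMatrix {n : ℕ} {F : Type*} [Field F] (r : Fin n → Fin n → Prop)
    (d : Fin n → Fˣ) (t : {p : Fin n × Fin n // r p.1 p.2 ∧ p.1 ≠ p.2} → F) :
    Matrix (Fin n) (Fin n) F :=
  fun i j => if i = j then (d i : F) else if h : r i j ∧ i ≠ j then t ⟨(i, j), h⟩ else 0

theorem incidenceMatrix_apply_self {n : ℕ} {F : Type*} [Field F] (r : Fin n → Fin n → Prop)
    (d : Fin n → Fˣ) (t : {p : Fin n × Fin n // r p.1 p.2 ∧ p.1 ≠ p.2} → F) (i : Fin n) :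
    incidenceMatrix r d t i i = d i := by
  simp [incidenceMatrix]

theorem incidenceMatrix_apply_strict {n : ℕ} {F : Type*} [Field F] (r : Fin n → Fin n → Prop)
    (d : Fin n → Fˣ) (t : {p : Fin n × Fin n // r p.1 p.2 ∧ p.1 ≠ p.2} → F)
    (p : {p : Fin n × Fin n // r p.1 p.2 ∧ p.1 ≠ p.2}) :
    incidenceMatrix r d t p.1.1 p.1.2 = t p := by
  simp [incidenceMatrix, p.2]

theorem incidenceMatrix_apply_of_not {n : ℕ} {F : Type*} [Field F] {r : Fin n → Fin n → Prop}
    (hrefl : ∀ i, r i i) (d : Fin n → Fˣ)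
    (t : {p : Fin n × Fin n // r p.1 p.2 ∧ p.1 ≠ p.2} → F) {i j : Fin n} (h : ¬ r i j) :
    incidenceMatrix r d t i j = 0 := by
  have hij : i ≠ j := fun e => h (e ▸ hrefl i)
  simp [incidenceMatrix, h, hij]

theorem det_incidenceMatrix_ne_zero {n : ℕ} {F : Type*} [Field F] {r : Fin n → Fin n → Prop}
    (hrefl : ∀ i, r i i) (hle : ∀ i j, r i j → i ≤ j) (d : Fin n → Fˣ)
    (t : {p : Fin n × Fin n // r p.1 p.2 ∧ p.1 ≠ p.2} → F) :
    (incidenceMatrix r d t).det ≠ 0 := by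
  rw [det_eq_prod_diag_of_incidence hle fun i j h => incidenceMatrix_apply_of_not hrefl d t h]
  simp [Finset.prod_ne_zero_iff, incidenceMatrix_apply_self]

theorem incidenceSubgroup_diag_ne_zero {n : ℕ} {F : Type*} [Field F] [Finite F]
    {r : Fin n → Fin n → Prop} {hrefl : ∀ i, r i i}
    {htrans : ∀ i j k, r i j → r j k → r i k} (hle : ∀ i j, r i j → i ≤ j)
    (X : incidenceSubgroup F r hrefl htrans) (i : Fin n) :
    (X : Matrix.GeneralLinearGroup (Fin n) F).val i i ≠ 0 := by
  have h := X.1.det_ne_zero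
  rw [det_eq_prod_diag_of_incidence hle X.2, Finset.prod_ne_zero_iff] at h
  exact h i (Finset.mem_univ i)

/-- An element of the incidence group is determined by its diagonal, made of units, and by its
entries at the strict relations, which are arbitrary. -/
noncomputable def incidenceSubgroupEquiv {n : ℕ} {F : Type*} [Field F] [Finite F]
    {r : Fin n → Fin n → Prop} (hrefl : ∀ i, r i i)
    (htrans : ∀ i j k, r i j → r j k → r i k) (hle : ∀ i j, r i j → i ≤ j) :
    incidenceSubgroup F r hrefl htrans ≃
      (Fin n → Fˣ) × ({p : Fin n × Fin n // r p.1 p.2 ∧ p.1 ≠ p.2} → F) where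
  toFun X := (fun i => Units.mk0 (X.1.val i i) (incidenceSubgroup_diag_ne_zero hle X i),
    fun p => X.1.val p.1.1 p.1.2)
  invFun y := ⟨Matrix.GeneralLinearGroup.mkOfDetNeZero (incidenceMatrix r y.1 y.2)
      (det_incidenceMatrix_ne_zero hrefl hle y.1 y.2),
    fun _ _ h => incidenceMatrix_apply_of_not hrefl y.1 y.2 h⟩
  left_inv X := by
    refine Subtype.ext (Units.ext (Matrix.ext fun i j => ?_))
    change incidenceMatrix r _ _ i j = X.1.val i j
    by_cases hij : i = j
    · subst hij
      simp [incidenceMatrix_apply_self]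
    · by_cases h : r i j
      · exact incidenceMatrix_apply_strict r _ _ ⟨(i, j), h, hij⟩
      · rw [incidenceMatrix_apply_of_not hrefl _ _ h, X.2 i j h]
  right_inv y := Prod.ext
    (funext fun i => Units.ext (incidenceMatrix_apply_self r y.1 y.2 i))
    (funext fun p => incidenceMatrix_apply_strict r y.1 y.2 p)

theorem card_incidenceSubgroup {n : ℕ} {F : Type*} [Field F] [Fintype F]
    {r : Fin n → Fin n → Prop} (hrefl : ∀ i, r i i)
    (htrans : ∀ i j k, r i j → r j k → r i k) (hle : ∀ i j, r i j → i ≤ j) :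
    Nat.card (incidenceSubgroup F r hrefl htrans) =
      (Fintype.card F - 1) ^ n *
        Fintype.card F ^ Nat.card {p : Fin n × Fin n // r p.1 p.2 ∧ p.1 ≠ p.2} := by
  rw [Nat.card_congr (incidenceSubgroupEquiv hrefl htrans hle), Nat.card_prod, Nat.card_fun,
    Nat.card_fun, Nat.card_units]
  simp only [Nat.card_eq_fintype_card, Fintype.card_fin]

theorem card_strict_relations_le {n : ℕ} {r : Fin n → Fin n → Prop}
    (hle : ∀ i j, r i j → i ≤ j) :
    Nat.card {p : Fin n × Fin n // r p.1 p.2 ∧ p.1 ≠ p.2} ≤ n * (n - 1) / 2 := by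
  let f : {p : Fin n × Fin n // r p.1 p.2 ∧ p.1 ≠ p.2} → Σ j : Fin n, Fin j := fun p =>
    ⟨p.1.2, p.1.1, (hle _ _ p.2.1).lt_of_ne p.2.2⟩
  have hf : Function.Injective f := by
    rintro ⟨⟨i, j⟩, h⟩ ⟨⟨i', j'⟩, h'⟩ e
    simp only [f, Sigma.mk.injEq] at e
    obtain ⟨rfl, e⟩ := e
    simpa [Fin.ext_iff] using e
  refine (Nat.card_le_card_of_injective f hf).trans_eq ?_
  rw [Nat.card_eq_fintype_card, Fintype.card_sigma, ← Finset.sum_range_id,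
    ← Fin.sum_univ_eq_sum_range (fun i => i)]
  simp

theorem prod_pow_sub_pow_eq {q : ℕ} (hq : 1 ≤ q) (n : ℕ) :
    ∏ i : Fin n, (q ^ n - q ^ (i : ℕ)) =
      q ^ (n * (n - 1) / 2) * ((q - 1) ^ n *
        ∏ k ∈ Finset.Icc 1 n, ∑ i ∈ Finset.range k, q ^ i) := by
  have hgeom (k : ℕ) : (q - 1) * ∑ i ∈ Finset.range k, q ^ i = q ^ k - 1 := by
    rw [mul_comm, geom_sum_mul_of_one_le hq]
  have hIcc : ∏ k ∈ Finset.Icc 1 n, (q ^ k - 1) = ∏ i ∈ Finset.range n, (q ^ (n - i) - 1) := by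
    rw [Finset.range_eq_Ico, Finset.prod_Ico_reflect (fun k => q ^ k - 1) 0 n.le_succ,
      ← Finset.Ico_add_one_right_eq_Icc, Nat.add_sub_cancel_left, Nat.sub_zero]
  calc ∏ i : Fin n, (q ^ n - q ^ (i : ℕ))
      = ∏ i ∈ Finset.range n, (q ^ n - q ^ i) :=
        Fin.prod_univ_eq_prod_range (fun i => q ^ n - q ^ i) n
    _ = ∏ i ∈ Finset.range n, (q ^ i * (q ^ (n - i) - 1)) := by
        refine Finset.prod_congr rfl fun i hi => ?_
        rw [Nat.mul_sub, ← pow_add, Nat.add_sub_cancel' (Finset.mem_range.mp hi).le, mul_one]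
    _ = q ^ (n * (n - 1) / 2) * ∏ k ∈ Finset.Icc 1 n, (q ^ k - 1) := by
        rw [Finset.prod_mul_distrib, Finset.prod_pow_eq_pow_sum, Finset.sum_range_id, hIcc]
    _ = _ := by
        simp only [← hgeom, Finset.prod_mul_distrib, Finset.prod_const, Nat.card_Icc,
          Nat.add_sub_cancel]

/-- The left cosets of a subgroup, as sets, are counted by its index. -/
theorem card_leftCosets_eq_index {G : Type*} [Group G] (H : Subgroup G) :
    Nat.card {S : Set G // ∃ b : G, S = {c | ∃ x : G, x ∈ H ∧ c = b * x}} = H.index := by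
  let f : G ⧸ H → Set G := fun a => {c | (c : G ⧸ H) = a}
  have hcoset (b : G) : {c | ∃ x : G, x ∈ H ∧ c = b * x} = f b := by
    ext c
    rw [Set.mem_ofPred_eq, Set.mem_ofPred_eq, eq_comm, QuotientGroup.eq]
    exact ⟨fun ⟨x, hx, e⟩ => by simpa [e] using hx, fun h => ⟨b⁻¹ * c, h, by simp⟩⟩
  have hf : Function.Injective f := fun a b h => by
    induction a using QuotientGroup.induction_on with
    | H a => exact (Set.ext_iff.mp h a).mp rfl
  refine (Nat.card_congr
    ((Equiv.ofInjective f hf).trans (Equiv.subtypeEquivRight fun S => ?_))).symm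
  simp only [hcoset, Set.mem_range]
  exact ⟨fun ⟨a, ha⟩ => by
    induction a using QuotientGroup.induction_on with
    | H a => exact ⟨a, ha.symm⟩, fun ⟨b, hb⟩ => ⟨b, hb.symm⟩⟩

/-- Over a finite field with `q` elements, the number of left
cosets of `I*(P;F_q)` in `GL(n,F_q)` equals
`q^{n(n-1)/2 - |T_P|} * ∏_{k=1}^n [k]_q`. -/
theorem stmt_3 (n : ℕ) (hn : 1 ≤ n) (q : ℕ) (F : Type*) [Field F] [Fintype F]
    [DecidableEq F] (hq : Fintype.card F = q)
    (leP : Fin n → Fin n → Prop)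
    (hPrefl : ∀ i, leP i i) (hPtrans : ∀ i j k, leP i j → leP j k → leP i k)
    (hPnat : ∀ i j, leP i j → i ≤ j) :
    Nat.card {S : Set (Matrix.GeneralLinearGroup (Fin n) F) //
        ∃ B : Matrix.GeneralLinearGroup (Fin n) F,
          S = {C | ∃ X : Matrix.GeneralLinearGroup (Fin n) F,
            (∀ i j, ¬ leP i j → (X : Matrix (Fin n) (Fin n) F) i j = 0) ∧ C = B * X}}
      = q ^ (n * (n - 1) / 2 - Nat.card {p : Fin n × Fin n // leP p.1 p.2 ∧ p.1 ≠ p.2})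
          * ∏ k ∈ Finset.Icc 1 n, (∑ i ∈ Finset.range k, q ^ i) := by
  subst hq
  have hF : 1 < Fintype.card F := Fintype.one_lt_card
  have hindex := card_leftCosets_eq_index (incidenceSubgroup F leP hPrefl hPtrans)
  simp only [mem_incidenceSubgroup] at hindex
  have hmul := (incidenceSubgroup F leP hPrefl hPtrans).card_mul_index
  rw [Matrix.card_GL_field, prod_pow_sub_pow_eq hF.le, card_incidenceSubgroup hPrefl hPtrans hPnat]
    at hmul
  rw [hindex]
  have hpos : 0 < (Fintype.card F - 1) ^ n * Fintype.card F ^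
      Nat.card {p : Fin n × Fin n // leP p.1 p.2 ∧ p.1 ≠ p.2} :=
    mul_pos (pow_pos (by omega) _) (pow_pos (by omega) _)
  refine Nat.eq_of_mul_eq_mul_left hpos (hmul.trans ?_)
  rw [← Nat.add_sub_cancel' (card_strict_relations_le hPnat), pow_add, Nat.add_sub_cancel_left]
  ring
end

section
/- Let n ≥ 1, F a field, P, Q ∈ Pos(n), and σ a permutation of Fin n. Let A ∈ I*(Q;F), i.e. A is invertible and A i j = 0 whenever ¬(i ≤_Q j). Then A maps the subspace V_j := span{e_{σ(i)} : i ≤_P j} of F^n onto itself for every j ∈ Fin n if and only if A i j = 0 whenever ¬(σ⁻¹(i) ≤_P σ⁻¹(j)). In other words, the isotropy group of the P-flag F_σ^P = (V_1,…,V_n) under the action of I*(Q;F) is the incidence group I*([QP]_σ;F). -/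
/-- A vector lies in the span of the standard basis vectors indexed by `f '' S`, for a permutation
`f`, iff its coordinates outside `f '' S` vanish. -/
theorem mem_span_single_perm_iff {ι F : Type*} [Fintype ι] [DecidableEq ι] [Semiring F]
    (f : Equiv.Perm ι) (S : Set ι) (v : ι → F) :
    v ∈ Submodule.span F ((fun i : ι => Pi.single (M := fun _ => F) (f i) (1 : F)) '' S) ↔
      ∀ k, f.symm k ∉ S → v k = 0 := by
  constructor
  · intro hv k hk
    induction hv using Submodule.span_induction with
    | mem x hx =>
      obtain ⟨i, hi, rfl⟩ := hx
      refine Pi.single_eq_of_ne ?_ _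
      rintro rfl
      exact hk (by simpa using hi)
    | zero => rfl
    | add x y _ _ hx hy => simp [hx, hy]
    | smul a x _ hx => simp [hx]
  · intro h
    rw [pi_eq_sum_univ' v]
    refine Submodule.sum_mem _ fun k _ => ?_
    by_cases hk : f.symm k ∈ S
    · refine Submodule.smul_mem _ _ (Submodule.subset_span ⟨f.symm k, hk, ?_⟩)
      ext l
      simp [Pi.single_apply]
    · simp [h k hk]

/-- For `A ∈ I*(Q;F)`, the matrix `A` maps each subspace
`V_j = span{e_{σ(i)} : i ≤_P j}` onto itself iff `A i j = 0` whenever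
`¬(σ⁻¹(i) ≤_P σ⁻¹(j))`; i.e. the isotropy group of the `P`-flag `F_σ^P` under
the action of `I*(Q;F)` is the incidence group `I*([QP]_σ;F)`. -/
theorem stmt_5 (n : ℕ) (hn : 1 ≤ n) (F : Type*) [Field F]
    (leP leQ : Fin n → Fin n → Prop)
    (hPrefl : ∀ i, leP i i) (hPtrans : ∀ i j k, leP i j → leP j k → leP i k)
    (hPnat : ∀ i j, leP i j → i ≤ j)
    (hQrefl : ∀ i, leQ i i) (hQtrans : ∀ i j k, leQ i j → leQ j k → leQ i k)
    (hQnat : ∀ i j, leQ i j → i ≤ j)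
    (σ : Equiv.Perm (Fin n))
    (A : Matrix.GeneralLinearGroup (Fin n) F)
    (hA : ∀ i j, ¬ leQ i j → (A : Matrix (Fin n) (Fin n) F) i j = 0) :
    (∀ j : Fin n,
        Submodule.map ((A : Matrix (Fin n) (Fin n) F).mulVecLin)
          (Submodule.span F ((fun i : Fin n => Pi.single (σ i) (1 : F)) '' {i | leP i j}))
          = Submodule.span F ((fun i : Fin n => Pi.single (σ i) (1 : F)) '' {i | leP i j}))
      ↔ (∀ i j, ¬ leP (σ.symm i) (σ.symm j) → (A : Matrix (Fin n) (Fin n) F) i j = 0) := by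
  constructor
  · intro h i j hij
    have hmem : (A : Matrix (Fin n) (Fin n) F).mulVecLin (Pi.single j 1) ∈ Submodule.span F
        ((fun i : Fin n => Pi.single (M := fun _ => F) (σ i) (1 : F)) ''
          {i | leP i (σ.symm j)}) := by
      rw [← h (σ.symm j)]
      exact Submodule.mem_map_of_mem
        (Submodule.subset_span ⟨σ.symm j, hPrefl _, by simp⟩)
    simpa using (mem_span_single_perm_iff σ _ _).1 hmem i hij
  · intro h j
    have hinj : Function.Injective (A : Matrix (Fin n) (Fin n) F).mulVecLin :=
      Matrix.mulVec_injective_iff_isUnit.2 A.isUnit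
    refine Submodule.eq_of_le_of_finrank_eq ?_
      (Submodule.equivMapOfInjective _ hinj _).finrank_eq.symm
    rw [Submodule.map_span_le]
    rintro _ ⟨i, hi, rfl⟩
    rw [mem_span_single_perm_iff]
    intro k hk
    simpa using h k (σ i) fun hki => hk (hPtrans _ _ _ (by simpa using hki) hi)
end

section
/- Let n ≥ 1, let F_q be a finite field with q elements, let Q ∈ Pos(n), and let I be a nonempty order ideal of Q. Then the number of vectors v : Fin n → F_q whose support {i : v i ≠ 0} has ≤_Q-lower closure equal to I is (q−1) · Σ_H (−1)^{|I∖H|} · [|H|]_q, where the sum ranges over all nonempty order ideals H of Q with H ⊆ I and I∖H ⊆ max(I), max(I) being the set of maximal elements of I with respect to ≤_Q, and [m]_q := 1 + q + ⋯ + q^{m−1}. -/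
/-- Vectors supported in `I` and nonvanishing on `M ⊆ I`. -/
theorem card_supported_nonvanishing {ι F : Type*} [Fintype ι] [DecidableEq ι] [Field F]
    [Fintype F] {M I : Finset ι} (hMI : M ⊆ I) :
    (Nat.card {v : ι → F // (∀ i, v i ≠ 0 → i ∈ I) ∧ ∀ i ∈ M, v i ≠ 0} : ℤ)
      = ((Fintype.card F : ℤ) - 1) ^ M.card * (Fintype.card F : ℤ) ^ (I.card - M.card) := by
  classical
  let S : ι → Finset F := fun i =>
    if i ∈ M then {0}ᶜ else if i ∈ I then Finset.univ else {0}
  have hS : ∀ v : ι → F,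
      ((∀ i, v i ≠ 0 → i ∈ I) ∧ ∀ i ∈ M, v i ≠ 0) ↔ v ∈ Fintype.piFinset S := by
    intro v
    simp only [Fintype.mem_piFinset, S, ← forall_and]
    refine forall_congr' fun i => ?_
    have := @hMI i
    by_cases hM : i ∈ M <;> by_cases hI : i ∈ I <;> simp_all
  have hcard : ∀ i, ((S i).card : ℤ) = (if i ∈ M then (Fintype.card F : ℤ) - 1 else 1) *
      (if i ∈ I \ M then (Fintype.card F : ℤ) else 1) := by
    intro i
    have hpos : 1 ≤ Fintype.card F := Fintype.card_pos
    by_cases hM : i ∈ M <;> by_cases hI : i ∈ I <;>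
      simp [S, hM, hI, Finset.card_compl, Nat.cast_sub hpos]
  rw [Nat.card_congr (Equiv.subtypeEquivRight hS), Nat.card_eq_fintype_card, Fintype.card_coe,
    Fintype.card_piFinset, Nat.cast_prod, Finset.prod_congr rfl fun i _ => hcard i,
    Finset.prod_mul_distrib, Finset.prod_ite_mem, Finset.prod_ite_mem, Finset.univ_inter,
    Finset.univ_inter, Finset.prod_const, Finset.prod_const, Finset.card_sdiff_of_subset hMI]

/-- Alternating sum of `q`-integers over the sets `H` with `I \ M ⊆ H ⊆ I`, indexed by `I \ H`. -/
theorem sub_one_mul_alternating_sum_geom {ι : Type*} [DecidableEq ι] {M I : Finset ι}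
    (hMI : M ⊆ I) (hM : M.Nonempty) (q : ℤ) :
    (q - 1) * ∑ T ∈ M.powerset, (-1) ^ T.card * ∑ i ∈ Finset.range (I \ T).card, q ^ i
      = (q - 1) ^ M.card * q ^ (I.card - M.card) := by
  have hle := Finset.card_le_card hMI
  have hterm : ∀ T ∈ M.powerset,
      (q - 1) * ((-1) ^ T.card * ∑ i ∈ Finset.range (I \ T).card, q ^ i) =
        (-1) ^ T.card * q ^ (M.card - T.card) * q ^ (I.card - M.card) - (-1) ^ T.card := by
    intro T hT
    rw [Finset.mem_powerset] at hT
    have hTM := Finset.card_le_card hT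
    rw [mul_left_comm, mul_comm (q - 1), geom_sum_mul,
      Finset.card_sdiff_of_subset (hT.trans hMI), mul_assoc, ← pow_add,
      show M.card - T.card + (I.card - M.card) = I.card - T.card by omega]
    ring
  rw [Finset.mul_sum, Finset.sum_congr rfl hterm, Finset.sum_sub_distrib, ← Finset.sum_mul,
    Finset.sum_pow_mul_eq_add_pow, Finset.sum_powerset_neg_one_pow_card_of_nonempty hM]
  ring

/-- Every element of a finite set lies below a maximal one. -/
theorem exists_maximal_above {n : ℕ} {leQ : Fin n → Fin n → Prop} [DecidableRel leQ]
    (hQrefl : ∀ i, leQ i i) (hQtrans : ∀ i j k, leQ i j → leQ j k → leQ i k)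
    (hQnat : ∀ i j, leQ i j → i ≤ j) {I : Finset (Fin n)} {j : Fin n} (hj : j ∈ I) :
    ∃ i ∈ I.filter (fun i => ∀ j ∈ I, leQ i j → j = i), leQ j i := by
  obtain ⟨m, hm, hmax⟩ := Finset.exists_max_image (I.filter (leQ j)) id
    ⟨j, Finset.mem_filter.2 ⟨hj, hQrefl j⟩⟩
  rw [Finset.mem_filter] at hm
  refine ⟨m, Finset.mem_filter.2 ⟨hm.1, fun k hk hmk => ?_⟩, hm.2⟩
  exact le_antisymm (hmax k (Finset.mem_filter.2 ⟨hk, hQtrans _ _ _ hm.2 hmk⟩)) (hQnat _ _ hmk)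

/-- Over a finite field with `q` elements, the number of vectors
whose support has `≤_Q`-lower closure equal to a given nonempty order ideal `I`
is `(q-1) · Σ_H (-1)^{|I∖H|}[|H|]_q`, the sum ranging over nonempty order
ideals `H ⊆ I` with `I∖H ⊆ max(I)`. -/
theorem stmt_8 (n : ℕ) (hn : 1 ≤ n) (q : ℕ) (F : Type*) [Field F] [Fintype F]
    (hq : Fintype.card F = q)
    (leQ : Fin n → Fin n → Prop) [DecidableRel leQ]
    (hQrefl : ∀ i, leQ i i) (hQtrans : ∀ i j k, leQ i j → leQ j k → leQ i k)
    (hQnat : ∀ i j, leQ i j → i ≤ j)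
    (I : Finset (Fin n)) (hIne : I.Nonempty)
    (hIideal : ∀ i ∈ I, ∀ j, leQ j i → j ∈ I) :
    (Nat.card {v : Fin n → F // {j | ∃ i, v i ≠ 0 ∧ leQ j i} = (I : Set (Fin n))} : ℤ)
      = ((q : ℤ) - 1) *
        ∑ H ∈ I.powerset.filter (fun H => H.Nonempty ∧
            (∀ i ∈ H, ∀ j, leQ j i → j ∈ H) ∧
            I \ H ⊆ I.filter (fun i => ∀ j ∈ I, leQ i j → j = i)),
          (-1 : ℤ) ^ ((I \ H).card) * ∑ i ∈ Finset.range H.card, (q : ℤ) ^ i := by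
  subst hq
  set M := I.filter (fun i => ∀ j ∈ I, leQ i j → j = i) with hMdef
  have hMI : M ⊆ I := Finset.filter_subset _ _
  have hMne : M.Nonempty := by
    obtain ⟨j, hj⟩ := hIne
    obtain ⟨i, hi, -⟩ := exists_maximal_above hQrefl hQtrans hQnat hj
    exact ⟨i, hi⟩
  have hclosure : ∀ v : Fin n → F, {j | ∃ i, v i ≠ 0 ∧ leQ j i} = (I : Set (Fin n)) ↔
      (∀ i, v i ≠ 0 → i ∈ I) ∧ ∀ i ∈ M, v i ≠ 0 := by
    intro v
    constructor
    · intro h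
      have hsupp : ∀ i, v i ≠ 0 → i ∈ I := fun i hi => by
        rw [← Finset.mem_coe, ← h]
        exact ⟨i, hi, hQrefl i⟩
      refine ⟨hsupp, fun i hi => ?_⟩
      have hmem : i ∈ {j | ∃ i, v i ≠ 0 ∧ leQ j i} := h ▸ hMI hi
      obtain ⟨k, hk, hik⟩ := hmem
      rwa [← (Finset.mem_filter.1 hi).2 k (hsupp k hk) hik]
    · rintro ⟨hsupp, hne⟩
      ext j
      constructor
      · rintro ⟨i, hi, hji⟩
        exact hIideal i (hsupp i hi) j hji
      · intro hj
        obtain ⟨i, hi, hji⟩ := exists_maximal_above hQrefl hQtrans hQnat hj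
        exact ⟨i, hne i hi, hji⟩
  rw [Nat.card_congr (Equiv.subtypeEquivRight hclosure), card_supported_nonvanishing hMI,
    ← sub_one_mul_alternating_sum_geom hMI hMne]
  congr 1
  symm
  refine Finset.sum_of_injOn (fun H => I \ H) ?_ ?_ ?_ ?_
  · intro H hH K hK h
    simp only [Finset.coe_filter, Finset.mem_powerset, Set.mem_ofPred_eq] at hH hK
    rw [← Finset.sdiff_sdiff_eq_self hH.1, ← Finset.sdiff_sdiff_eq_self hK.1]
    exact congrArg (I \ ·) h
  · intro H hH
    simp only [Finset.coe_filter, Finset.mem_powerset, Set.mem_ofPred_eq] at hH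
    exact Finset.mem_coe.2 (Finset.mem_powerset.2 hH.2.2.2)
  · intro T hT hnot
    rw [Finset.mem_powerset] at hT
    suffices hempty : I \ T = ∅ by simp [hempty]
    by_contra hne
    refine hnot ⟨I \ T, ?_, Finset.sdiff_sdiff_eq_self (hT.trans hMI)⟩
    simp only [Finset.coe_filter, Finset.mem_powerset, Set.mem_ofPred_eq]
    refine ⟨Finset.sdiff_subset, Finset.nonempty_iff_ne_empty.2 hne, fun i hi j hji => ?_, ?_⟩
    · rw [Finset.mem_sdiff] at hi ⊢
      refine ⟨hIideal i hi.1 j hji, fun hjT => hi.2 ?_⟩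
      rwa [(Finset.mem_filter.1 (hT hjT)).2 i hi.1 hji]
    · rwa [Finset.sdiff_sdiff_eq_self (hT.trans hMI)]
  · intro H hH
    rw [Finset.mem_filter, Finset.mem_powerset] at hH
    rw [Finset.sdiff_sdiff_eq_self hH.1]
end

section
/- Let n ≥ 1, let ≤_Q be a partial order on Fin n refining the natural order, and let k ≥ 1. On the collection of k-element subsets of Fin n, define s ≼_Q t if there exists a bijection φ : s → t with x ≤_Q φ(x) for all x ∈ s. Then ≼_Q is a partial order: it is reflexive, transitive, and antisymmetric (if s ≼_Q t and t ≼_Q s for k-element subsets s, t, then s = t). -/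
/-- A permutation of a finite partial order that moves no element outside its upper set is
the identity. -/
theorem Equiv.Perm.eq_one_of_forall_le {α : Type*} [Finite α] [PartialOrder α]
    (σ : Equiv.Perm α) (hσ : ∀ x, x ≤ σ x) : σ = 1 := by
  ext x
  have hmono : Monotone fun m : ℕ => (σ ^ m) x :=
    monotone_nat_of_le_succ fun m => by
      simpa only [pow_succ', Equiv.Perm.mul_apply] using hσ ((σ ^ m) x)
  have hle := hmono (Nat.one_le_iff_ne_zero.2 (orderOf_pos σ).ne')
  simp only [pow_one, pow_orderOf_eq_one, Equiv.Perm.one_apply] at hle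
  exact le_antisymm hle (hσ x)

/-- Two finite sets that dominate each other through bijections are equal. -/
theorem Finset.eq_of_equiv_le_of_equiv_le {α : Type*} [PartialOrder α] {s t : Finset α}
    (φ : {x // x ∈ s} ≃ {x // x ∈ t}) (ψ : {x // x ∈ t} ≃ {x // x ∈ s})
    (hφ : ∀ x, x.1 ≤ (φ x).1) (hψ : ∀ x, x.1 ≤ (ψ x).1) : s = t := by
  have hσ := Equiv.Perm.eq_one_of_forall_le (φ.trans ψ) fun x => (hφ x).trans (hψ (φ x))
  have hst : s ⊆ t := fun x hx => by
    have hfix : ψ (φ ⟨x, hx⟩) = ⟨x, hx⟩ := Equiv.congr_fun hσ ⟨x, hx⟩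
    have hle := hψ (φ ⟨x, hx⟩)
    rw [hfix] at hle
    have hx' : x = (φ ⟨x, hx⟩).1 := le_antisymm (hφ ⟨x, hx⟩) hle
    exact hx' ▸ (φ ⟨x, hx⟩).2
  exact Finset.eq_of_subset_of_card_le hst (Finset.card_eq_of_equiv φ).ge


/-- The relation `≼_Q` on `k`-element subsets of `Fin n`
(`s ≼_Q t` iff there is a bijection `φ : s → t` with `x ≤_Q φ(x)` for all
`x ∈ s`) is reflexive, transitive and antisymmetric, i.e. a partial order. -/
theorem stmt_9 (n : ℕ) (hn : 1 ≤ n) (k : ℕ) (hk : 1 ≤ k)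
    (leQ : Fin n → Fin n → Prop)
    (hQrefl : ∀ i, leQ i i) (hQtrans : ∀ i j l, leQ i j → leQ j l → leQ i l)
    (hQantisymm : ∀ i j, leQ i j → leQ j i → i = j)
    (hQnat : ∀ i j, leQ i j → i ≤ j) :
    (∀ s : Finset (Fin n), s.card = k →
      ∃ φ : {x // x ∈ s} ≃ {x // x ∈ s}, ∀ x, leQ x.1 (φ x).1) ∧
    (∀ s t u : Finset (Fin n), s.card = k → t.card = k → u.card = k →
      (∃ φ : {x // x ∈ s} ≃ {x // x ∈ t}, ∀ x, leQ x.1 (φ x).1) →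
      (∃ ψ : {x // x ∈ t} ≃ {x // x ∈ u}, ∀ x, leQ x.1 (ψ x).1) →
      (∃ χ : {x // x ∈ s} ≃ {x // x ∈ u}, ∀ x, leQ x.1 (χ x).1)) ∧
    (∀ s t : Finset (Fin n), s.card = k → t.card = k →
      (∃ φ : {x // x ∈ s} ≃ {x // x ∈ t}, ∀ x, leQ x.1 (φ x).1) →
      (∃ ψ : {x // x ∈ t} ≃ {x // x ∈ s}, ∀ x, leQ x.1 (ψ x).1) →
      s = t) := by
  refine ⟨fun s _ => ⟨Equiv.refl _, fun x => hQrefl x.1⟩, ?_, ?_⟩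
  · rintro s t u - - - ⟨φ, hφ⟩ ⟨ψ, hψ⟩
    exact ⟨φ.trans ψ, fun x => hQtrans _ _ _ (hφ x) (hψ (φ x))⟩
  · rintro s t - - ⟨φ, hφ⟩ ⟨ψ, hψ⟩
    exact Finset.eq_of_equiv_le_of_equiv_le φ ψ (fun x => hQnat _ _ (hφ x))
      fun x => hQnat _ _ (hψ x)
end

section
/- Let n ≥ 1, let ≤_Q be a partial order on Fin n refining the natural order, let k ≥ 1, and let a, b : Fin k → Fin n be strictly increasing tuples. If there exists a permutation σ of Fin k with a(σ(i)) ≤_Q b(i) for all i, then a ≤ b in the lexicographic order on tuples (i.e. toLex a ≤ toLex b). -/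
/-- An injective self-map of `Fin k` cannot map `{0, …, i}` into `{0, …, i - 1}`. -/
theorem Fin.exists_le_le_apply_of_injective {k : ℕ} {f : Fin k → Fin k}
    (hf : Function.Injective f) (i : Fin k) : ∃ j ≤ i, i ≤ f j := by
  by_contra! hlt
  have hcard : (Finset.Iic i).card ≤ (Finset.Iio i).card :=
    Finset.card_le_card_of_injOn f
      (fun j hj => by simpa using hlt j (by simpa using hj)) hf.injOn
  simp at hcard

/-- Monotone tuples that are comparable entrywise up to an injective reindexing are comparable
entrywise. -/
theorem Monotone.le_of_comp_injective_le {k : ℕ} {α : Type*} [Preorder α] {a b : Fin k → α}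
    (ha : Monotone a) (hb : Monotone b) {f : Fin k → Fin k} (hf : Function.Injective f)
    (h : ∀ i, a (f i) ≤ b i) : a ≤ b := by
  intro i
  obtain ⟨j, hji, hij⟩ := Fin.exists_le_le_apply_of_injective hf i
  exact (ha hij).trans ((h j).trans (hb hji))

/-- If `a, b` are strictly increasing `k`-tuples in `Fin n` and
`a ≼_Q b` (there is a permutation `σ` with `a(σ(i)) ≤_Q b(i)` for all `i`),
then `a ≤ b` in the lexicographic order. -/
theorem stmt_11 (n : ℕ) (hn : 1 ≤ n) (k : ℕ) (hk : 1 ≤ k)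
    (leQ : Fin n → Fin n → Prop)
    (hQrefl : ∀ i, leQ i i) (hQtrans : ∀ i j l, leQ i j → leQ j l → leQ i l)
    (hQnat : ∀ i j, leQ i j → i ≤ j)
    (a b : Fin k → Fin n) (ha : StrictMono a) (hb : StrictMono b)
    (h : ∃ σ : Equiv.Perm (Fin k), ∀ i, leQ (a (σ i)) (b i)) :
    toLex a ≤ toLex b := by
  obtain ⟨σ, hσ⟩ := h
  exact Pi.toLex_monotone
    (ha.monotone.le_of_comp_injective_le hb.monotone σ.injective fun i => hQnat _ _ (hσ i))
end

section
/- Let n ≥ 1, let ≤_Q be a partial order on Fin n refining the natural order, and let 1 ≤ k ≤ n−1. For k-element subsets s, t of Fin n, one has s ≼_Q t if and only if (Fin n ∖ t) ≼_Q (Fin n ∖ s), where the complements are (n−k)-element subsets. Consequently, the poset Q^k_< of k-subsets under ≼_Q is isomorphic to the order dual of the poset Q^{n−k}_< of (n−k)-subsets under ≼_Q, via complementation. -/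
/-- If a bijection `s ≃ t` moves every element up along a preorder `r`, then so does some
bijection `tᶜ ≃ sᶜ`. -/
theorem exists_compl_equiv_of_exists_equiv {α : Type*} [Fintype α] [DecidableEq α]
    {r : α → α → Prop} (hrefl : ∀ i, r i i) (htrans : ∀ i j l, r i j → r j l → r i l)
    {s t : Finset α} (h : ∃ φ : {x // x ∈ s} ≃ {x // x ∈ t}, ∀ x, r x.1 (φ x).1) :
    ∃ ψ : {x // x ∈ tᶜ} ≃ {x // x ∈ sᶜ}, ∀ x, r x.1 (ψ x).1 := by
  classical
  obtain ⟨φ, hφ⟩ := h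
  have hall : ∀ A : Finset {x // x ∈ tᶜ},
      A.card ≤ (A.biUnion fun x => sᶜ.filter fun y => r x.1 y).card := by
    intro A
    -- compare the upper closure `U` of `A` with `s` and `t`
    set U : Finset α := Finset.univ.filter fun y => ∃ x ∈ A, r x.1 y with hU
    have hst : (U ∩ s).card ≤ (U ∩ t).card := by
      refine Finset.card_le_card_of_injOn
        (fun x => if hx : x ∈ s then (φ ⟨x, hx⟩).1 else x) ?_ ?_
      · intro x hx
        obtain ⟨hxU, hxs⟩ := Finset.mem_inter.1 hx
        obtain ⟨a, ha, hax⟩ := (Finset.mem_filter.1 hxU).2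
        simp only [hxs, dif_pos, Finset.mem_coe, Finset.mem_inter]
        exact ⟨Finset.mem_filter.2 ⟨Finset.mem_univ _, a, ha, htrans _ _ _ hax (hφ ⟨x, hxs⟩)⟩,
          (φ ⟨x, hxs⟩).2⟩
      · intro x hx y hy hxy
        have hxs := (Finset.mem_inter.1 hx).2
        have hys := (Finset.mem_inter.1 hy).2
        simp only [hxs, hys, dif_pos] at hxy
        exact congrArg Subtype.val (φ.injective (Subtype.ext hxy))
    have hA : A.card ≤ (U \ t).card := by
      rw [← Finset.card_map (Function.Embedding.subtype _)]
      refine Finset.card_le_card fun y hy => ?_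
      obtain ⟨a, ha, rfl⟩ := Finset.mem_map.1 hy
      exact Finset.mem_sdiff.2 ⟨Finset.mem_filter.2 ⟨Finset.mem_univ _, a, ha, hrefl _⟩,
        Finset.mem_compl.1 a.2⟩
    have hN : (A.biUnion fun x => sᶜ.filter fun y => r x.1 y) = U \ s := by
      ext y
      simp only [hU, Finset.mem_biUnion, Finset.mem_filter, Finset.mem_compl, Finset.mem_sdiff,
        Finset.mem_univ, true_and]
      tauto
    rw [hN]
    have h₁ := Finset.card_inter_add_card_sdiff U s
    have h₂ := Finset.card_inter_add_card_sdiff U t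
    omega
  obtain ⟨f, hf, hfr⟩ := (Finset.all_card_le_biUnion_card_iff_exists_injective _).1 hall
  have hcard : Fintype.card {x // x ∈ tᶜ} = Fintype.card {x // x ∈ sᶜ} := by
    have := Fintype.card_congr φ
    simp only [Fintype.card_coe] at this
    simp only [Fintype.card_coe, Finset.card_compl, this]
  let g : {x // x ∈ tᶜ} → {x // x ∈ sᶜ} := fun x => ⟨f x, (Finset.mem_filter.1 (hfr x)).1⟩
  have hg : Function.Injective g := fun x y hxy => hf (congrArg Subtype.val hxy)
  exact ⟨Equiv.ofBijective g ((Fintype.bijective_iff_injective_and_card g).2 ⟨hg, hcard⟩),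
    fun x => (Finset.mem_filter.1 (hfr x)).2⟩

/-- For `k`-element subsets `s, t` of `Fin n`, one has
`s ≼_Q t` iff `tᶜ ≼_Q sᶜ`; hence complementation is an isomorphism between
the poset `Q^k_<` and the order dual of `Q^{n-k}_<`. -/
theorem stmt_12 (n : ℕ) (hn : 1 ≤ n) (k : ℕ) (hk : 1 ≤ k) (hkn : k ≤ n - 1)
    (leQ : Fin n → Fin n → Prop)
    (hQrefl : ∀ i, leQ i i) (hQtrans : ∀ i j l, leQ i j → leQ j l → leQ i l)
    (hQnat : ∀ i j, leQ i j → i ≤ j)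
    (s t : Finset (Fin n)) (hs : s.card = k) (ht : t.card = k) :
    (∃ φ : {x // x ∈ s} ≃ {x // x ∈ t}, ∀ x, leQ x.1 (φ x).1)
      ↔ (∃ ψ : {x // x ∈ tᶜ} ≃ {x // x ∈ sᶜ}, ∀ x, leQ x.1 (ψ x).1) := by
  refine ⟨exists_compl_equiv_of_exists_equiv hQrefl hQtrans, fun h => ?_⟩
  have h' := exists_compl_equiv_of_exists_equiv hQrefl hQtrans h
  rwa [compl_compl, compl_compl] at h'
end

section
/- Let n ≥ 1, F a field, and let ≤_Q be a partial order on Fin n refining the natural order. Let A be an n×n matrix over F with A i j = 0 whenever ¬(i ≤_Q j). Let k ≥ 1 and let s, t : Fin k → Fin n be strictly increasing tuples. If the determinant of the k×k submatrix of A with rows s and columns t is nonzero, then there exists a permutation σ of Fin k with s(σ(i)) ≤_Q t(i) for all i. Equivalently, the k-th compound (exterior power) matrix of any element of the incidence algebra of Q lies in the incidence algebra of the poset Q^k_<. -/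
/-- If `A` lies in the incidence algebra of `Q` and the `k×k`
minor of `A` with rows `s` and columns `t` (both strictly increasing tuples)
is nonzero, then there is a permutation `σ` of `Fin k` with
`s(σ(i)) ≤_Q t(i)` for all `i`; i.e. the `k`-th compound matrix of `A` lies in
the incidence algebra of `Q^k_<`. -/
theorem stmt_13 (n : ℕ) (hn : 1 ≤ n) (F : Type*) [Field F]
    (leQ : Fin n → Fin n → Prop)
    (hQrefl : ∀ i, leQ i i) (hQtrans : ∀ i j l, leQ i j → leQ j l → leQ i l)
    (hQnat : ∀ i j, leQ i j → i ≤ j)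
    (A : Matrix (Fin n) (Fin n) F)
    (hA : ∀ i j, ¬ leQ i j → A i j = 0)
    (k : ℕ) (hk : 1 ≤ k)
    (s t : Fin k → Fin n) (hs : StrictMono s) (ht : StrictMono t)
    (hdet : (A.submatrix s t).det ≠ 0) :
    ∃ σ : Equiv.Perm (Fin k), ∀ i, leQ (s (σ i)) (t i) := by
  contrapose! hdet
  rw [Matrix.det_apply]
  refine Finset.sum_eq_zero fun σ _ => ?_
  obtain ⟨i, hi⟩ := hdet σ
  rw [Finset.prod_eq_zero (Finset.mem_univ i) (hA _ _ hi), smul_zero]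
end

section
/- Let n ≥ 1, F a field, ≤_Q a partial order on Fin n refining the natural order, and 1 ≤ k ≤ n. For an n×k matrix M over F of rank k, let B(M) denote the set of k-element subsets s of Fin n such that the k×k submatrix of M with rows s (taken in increasing order) has nonzero determinant. Let I be a nonempty collection of k-element subsets of Fin n that is downward closed under ≼_Q. Then the following are equivalent: (a) there exists an n×k matrix M over F of rank k such that the ≼_Q-lower closure of B(M) equals I; (b) there exist a subset I′ ⊆ I and an n×k matrix N over F of rank k such that B(N) = max(I) ∪ I′, where max(I) is the set of ≼_Q-maximal elements of I. -/
/-- If a bijection `φ : s ≃ t` never decreases elements, and the elements of `t` do not have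
larger total than those of `s`, then `s = t`. -/
lemma eq_of_equiv_le_of_sum_le {n : ℕ} {s t : Finset (Fin n)}
    (φ : {x // x ∈ s} ≃ {x // x ∈ t}) (hφ : ∀ x, x.1 ≤ (φ x).1)
    (hsum : ∑ x ∈ t, (x : ℕ) ≤ ∑ x ∈ s, (x : ℕ)) : s = t := by
  have hle : ∀ x ∈ (Finset.univ : Finset {x // x ∈ s}), (x.1 : ℕ) ≤ ((φ x).1 : ℕ) :=
    fun x _ => hφ x
  have htsum : ∑ x, ((φ x).1 : ℕ) = ∑ x ∈ t, (x : ℕ) := by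
    rw [Equiv.sum_comp φ (fun y => (y.1 : ℕ))]
    exact Finset.sum_coe_sort t (fun x => (x : ℕ))
  have hssum : ∑ x : {x // x ∈ s}, (x.1 : ℕ) = ∑ x ∈ s, (x : ℕ) :=
    Finset.sum_coe_sort s (fun x => (x : ℕ))
  have heq := (Finset.sum_eq_sum_iff_of_le hle).1
    (le_antisymm (Finset.sum_le_sum hle) (by rw [htsum, hssum]; exact hsum))
  have hfix : ∀ x, x.1 = (φ x).1 := fun x => Fin.ext (heq x (Finset.mem_univ x))
  refine Finset.eq_of_subset_of_card_le (fun x hx => ?_) ?_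
  · rw [show x = (φ ⟨x, hx⟩).1 from hfix ⟨x, hx⟩]
    exact (φ ⟨x, hx⟩).2
  · simpa using (Fintype.card_congr φ).ge

/-- For a nonempty order ideal `I` of `Q^k_<`, there is a rank-`k`
matrix `M` whose set of bases `B(M)` has `≼_Q`-lower closure equal to `I` iff
there are `I' ⊆ I` and a rank-`k` matrix `N` with `B(N) = max(I) ∪ I'`. -/
theorem stmt_14 (n : ℕ) (hn : 1 ≤ n) (k : ℕ) (hk1 : 1 ≤ k) (hkn : k ≤ n)
    (F : Type*) [Field F]
    (leQ : Fin n → Fin n → Prop)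
    (hQrefl : ∀ i, leQ i i) (hQtrans : ∀ i j l, leQ i j → leQ j l → leQ i l)
    (hQnat : ∀ i j, leQ i j → i ≤ j)
    -- `pre s t` is the relation `s ≼_Q t` on subsets of `Fin n`
    (pre : Finset (Fin n) → Finset (Fin n) → Prop)
    (hpre : ∀ s t, pre s t ↔ ∃ φ : {x // x ∈ s} ≃ {x // x ∈ t}, ∀ x, leQ x.1 (φ x).1)
    -- `Bases M` is the set `B(M)` of `k`-subsets indexing invertible row-submatrices
    (Bases : Matrix (Fin n) (Fin k) F → Set (Finset (Fin n)))
    (hBases : ∀ M s, s ∈ Bases M ↔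
      ∃ h : s.card = k, (M.submatrix (s.orderEmbOfFin h) id).det ≠ 0)
    -- `I` is a nonempty order ideal of `Q^k_<`
    (I : Set (Finset (Fin n))) (hIne : I.Nonempty)
    (hIcard : ∀ s ∈ I, s.card = k)
    (hIdc : ∀ s ∈ I, ∀ t : Finset (Fin n), t.card = k → pre t s → t ∈ I) :
    (∃ M : Matrix (Fin n) (Fin k) F, M.rank = k ∧
        {t | ∃ s ∈ Bases M, pre t s} = I)
      ↔ (∃ I' ⊆ I, ∃ N : Matrix (Fin n) (Fin k) F, N.rank = k ∧
          Bases N = {s | s ∈ I ∧ ∀ t ∈ I, pre s t → s = t} ∪ I') := by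
  have card_eq : ∀ s t, pre s t → s.card = t.card := fun s t h => by
    obtain ⟨φ, -⟩ := (hpre s t).1 h
    simpa using Fintype.card_congr φ
  have refl : ∀ s, pre s s := fun s => (hpre s s).2 ⟨Equiv.refl _, fun x => hQrefl x.1⟩
  have trans : ∀ s t u, pre s t → pre t u → pre s u := fun s t u hst htu => by
    obtain ⟨φ, hφ⟩ := (hpre s t).1 hst
    obtain ⟨ψ, hψ⟩ := (hpre t u).1 htu
    exact (hpre s u).2 ⟨φ.trans ψ, fun x => hQtrans _ _ _ (hφ x) (hψ (φ x))⟩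
  have exists_max : ∀ t ∈ I, ∃ s ∈ I, (∀ u ∈ I, pre s u → s = u) ∧ pre t s := fun t ht => by
    obtain ⟨s, ⟨hsI, hts⟩, hmax⟩ := Set.exists_max_image {s | s ∈ I ∧ pre t s}
      (fun s => ∑ x ∈ s, (x : ℕ)) (Set.toFinite _) ⟨t, ht, refl t⟩
    refine ⟨s, hsI, fun u hu hsu => ?_, hts⟩
    obtain ⟨φ, hφ⟩ := (hpre s u).1 hsu
    exact eq_of_equiv_le_of_sum_le φ (fun x => hQnat _ _ (hφ x))
      (hmax u ⟨hu, trans _ _ _ hts hsu⟩)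
  constructor
  · rintro ⟨M, hM, rfl⟩
    have hsub : Bases M ⊆ {t | ∃ s ∈ Bases M, pre t s} := fun s hs => ⟨s, hs, refl s⟩
    refine ⟨Bases M, hsub, M, hM, (Set.union_eq_self_of_subset_left ?_).symm⟩
    rintro s ⟨⟨u, hu, hsu⟩, hmax⟩
    rwa [hmax u (hsub hu) hsu]
  · rintro ⟨I', hI', N, hN, hB⟩
    refine ⟨N, hN, Set.ext fun t => ⟨?_, fun ht => ?_⟩⟩
    · rintro ⟨s, hs, hts⟩
      have hsI : s ∈ I := by
        rw [hB] at hs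
        exact hs.elim And.left (@hI' s)
      exact hIdc s hsI t ((card_eq t s hts).trans (hIcard s hsI)) hts
    · obtain ⟨s, hsI, hmax, hts⟩ := exists_max t ht
      exact ⟨s, hB ▸ Or.inl ⟨hsI, hmax⟩, hts⟩
end

section
/- Let n ≥ 1 and 1 ≤ k ≤ n. For k-element subsets of Fin n, let ≼ be the Gale order: s ≼ t iff there is a bijection φ : s → t with x ≤ φ(x) for all x ∈ s (natural order on Fin n). Let a ≼ b be k-subsets. Then the interval [a,b] = {c : |c| = k, a ≼ c ≼ b} is a matroid: for every permutation σ of Fin n, the interval [a,b] has a maximum with respect to the order s ≤^σ t defined by σ(s) ≼ σ(t). -/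
/-- The number of elements of `c` strictly below `j`. -/
def countBelow {n : ℕ} (c : Finset (Fin n)) (j : ℕ) : ℕ := (c.filter fun x => x.val < j).card

theorem countBelow_eq_card {n : ℕ} (c : Finset (Fin n)) : countBelow c n = c.card := by
  simp [countBelow]

theorem countBelow_zero {n : ℕ} (c : Finset (Fin n)) : countBelow c 0 = 0 := by
  simp [countBelow]

theorem countBelow_eq_add {n : ℕ} (c : Finset (Fin n)) {p q : ℕ} (h : p ≤ q) :
    countBelow c q = countBelow c p + (c.filter fun x => p ≤ x.val ∧ x.val < q).card := by
  unfold countBelow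
  rw [← Finset.card_union_of_disjoint]
  · congr 1
    ext x
    simp only [Finset.mem_filter, Finset.mem_union]
    grind
  · rw [Finset.disjoint_left]
    simp only [Finset.mem_filter]
    grind

theorem countBelow_add_le_add {n : ℕ} {c d : Finset (Fin n)} {p q : ℕ} (h : p ≤ q)
    (hdc : ∀ z ∈ d, p ≤ z.val → z.val < q → z ∈ c) :
    countBelow c p + countBelow d q ≤ countBelow c q + countBelow d p := by
  rw [countBelow_eq_add c h, countBelow_eq_add d h]
  have : (d.filter fun x => p ≤ x.val ∧ x.val < q).card ≤
      (c.filter fun x => p ≤ x.val ∧ x.val < q).card := by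
    apply Finset.card_le_card
    intro z
    simp only [Finset.mem_filter]
    grind
  omega

theorem countBelow_succ {n : ℕ} (c : Finset (Fin n)) (x : Fin n) :
    countBelow c (x.val + 1) = countBelow c x.val + if x ∈ c then 1 else 0 := by
  rw [countBelow_eq_add c (Nat.le_succ _)]
  congr 1
  have : (c.filter fun z => x.val ≤ z.val ∧ z.val < x.val + 1) = c.filter fun z => z = x := by
    ext z
    simp only [Finset.mem_filter, Fin.ext_iff]
    grind
  rw [this, Finset.filter_eq']
  split_ifs <;> simp

theorem countBelow_insert {n : ℕ} {c : Finset (Fin n)} {y : Fin n} (hy : y ∉ c) (j : ℕ) :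
    countBelow (insert y c) j = countBelow c j + if y.val < j then 1 else 0 := by
  unfold countBelow
  rw [Finset.filter_insert]
  split_ifs
  · rw [Finset.card_insert_of_notMem (by simp [hy])]
  · rfl

theorem countBelow_exchange {n : ℕ} {c : Finset (Fin n)} {x y : Fin n} (hx : x ∈ c) (hy : y ∉ c)
    (j : ℕ) :
    countBelow (insert y (c.erase x)) j + (if x.val < j then 1 else 0) =
      countBelow c j + if y.val < j then 1 else 0 := by
  have hx' := countBelow_insert (Finset.notMem_erase x c) j
  rw [Finset.insert_erase hx] at hx'
  rw [countBelow_insert (by simp [hy]), hx']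
  omega

/-- Two sets of equal size can be matched monotonically iff their counting functions compare. -/
theorem exists_equiv_le_iff_countBelow {n : ℕ} (s t : Finset (Fin n)) :
    (∃ φ : {x // x ∈ s} ≃ {x // x ∈ t}, ∀ x, (x.1 : Fin n) ≤ (φ x).1) ↔
      s.card = t.card ∧ ∀ j, countBelow t j ≤ countBelow s j := by
  constructor
  · rintro ⟨φ, hφ⟩
    refine ⟨Finset.card_eq_of_equiv φ, fun j => ?_⟩
    refine Finset.card_le_card_of_injOn
      (fun y => if h : y ∈ t then (φ.symm ⟨y, h⟩).1 else y) ?_ ?_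
    · intro y hy
      rw [Finset.mem_coe, Finset.mem_filter] at hy
      have := hφ (φ.symm ⟨y, hy.1⟩)
      simp only [Equiv.apply_symm_apply, Fin.le_def] at this
      simp only [hy.1, dite_true, Finset.mem_coe, Finset.mem_filter]
      exact ⟨Subtype.coe_prop _, this.trans_lt hy.2⟩
    · intro y hy z hz h
      rw [Finset.mem_coe, Finset.mem_filter] at hy hz
      simpa [hy.1, hz.1, Subtype.coe_inj] using h
  · rintro ⟨hcard, hcount⟩
    have key (i : Fin t.card) :
        (s.orderEmbOfFin hcard i : Fin n) ≤ t.orderEmbOfFin rfl i := by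
      by_contra! hlt
      have h := hcount ((t.orderEmbOfFin rfl i).val + 1)
      have ht : (Finset.Iic i).card ≤ countBelow t ((t.orderEmbOfFin rfl i).val + 1) := by
        refine Finset.card_le_card_of_injOn (t.orderEmbOfFin rfl) ?_
          (t.orderEmbOfFin rfl).injective.injOn
        intro l hl
        have hl' := (t.orderEmbOfFin rfl).monotone (Finset.mem_Iic.1 hl)
        simpa [Nat.lt_succ_iff] using hl'
      have hs : countBelow s ((t.orderEmbOfFin rfl i).val + 1) ≤ (Finset.Iio i).card := by
        refine (Finset.card_le_card (t := (Finset.Iio i).image (s.orderEmbOfFin hcard)) ?_).trans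
          Finset.card_image_le
        intro x hx
        obtain ⟨hxs, hxt⟩ := Finset.mem_filter.1 hx
        rw [← Finset.mem_coe, ← Finset.range_orderEmbOfFin s hcard] at hxs
        obtain ⟨l, rfl⟩ := hxs
        refine Finset.mem_image_of_mem _ (Finset.mem_Iio.2 ?_)
        refine (s.orderEmbOfFin hcard).lt_iff_lt.1 (lt_of_le_of_lt ?_ hlt)
        exact Fin.le_def.2 (Nat.lt_succ_iff.1 hxt)
      simp only [Fin.card_Iic, Fin.card_Iio] at ht hs
      omega
    refine ⟨(s.orderIsoOfFin hcard).symm.toEquiv.trans (t.orderIsoOfFin rfl).toEquiv, fun x => ?_⟩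
    have := key ((s.orderIsoOfFin hcard).symm x)
    rw [← Finset.coe_orderIsoOfFin_apply, ← Finset.coe_orderIsoOfFin_apply,
      OrderIso.apply_symm_apply] at this
    exact this

/-- Basis exchange for sets whose counting functions lie between two bounds. -/
theorem exists_exchange_countBelow {n : ℕ} {c d : Finset (Fin n)} (lo hi : ℕ → ℕ)
    (hcd : c.card = d.card)
    (hc : ∀ j, lo j ≤ countBelow c j ∧ countBelow c j ≤ hi j)
    (hd : ∀ j, lo j ≤ countBelow d j ∧ countBelow d j ≤ hi j)
    {x : Fin n} (hxc : x ∈ c) (hxd : x ∉ d) :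
    ∃ y ∈ d, y ∉ c ∧ ∀ j, lo j ≤ countBelow (insert y (c.erase x)) j ∧
      countBelow (insert y (c.erase x)) j ≤ hi j := by
  have hcs := countBelow_succ c x
  have hds := countBelow_succ d x
  simp only [hxc, hxd, if_true, if_false] at hcs hds
  rcases le_or_gt (countBelow d x.val) (countBelow c x.val) with hle | hlt
  · have hne : (d.filter fun y => y ∉ c ∧ x < y).Nonempty := by
      by_contra hempty
      have h := countBelow_add_le_add (c := c) (d := d) (p := x.val + 1) (q := n) x.isLt
        fun z hz hxz _ => by
          by_contra hzc
          exact hempty ⟨z, Finset.mem_filter.2 ⟨hz, hzc, Fin.lt_def.2 (by omega)⟩⟩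
      rw [countBelow_eq_card, countBelow_eq_card] at h
      omega
    obtain ⟨y, hy, hmin⟩ := Finset.exists_min_image _ id hne
    simp only [Finset.mem_filter, id, Fin.lt_def, Fin.le_def] at hy hmin
    refine ⟨y, hy.1, hy.2.1, fun j => ?_⟩
    have he := countBelow_exchange hxc hy.2.1 j
    have hcj := hc j
    have hdj := hd j
    by_cases hxj : x.val < j
    · by_cases hyj : y.val < j
      · simp only [hxj, hyj, if_true] at he
        omega
      · have h := countBelow_add_le_add (c := c) (d := d) (p := x.val + 1) (q := j) hxj
          fun z hz hxz hzj => by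
            by_contra hzc
            have := hmin z ⟨hz, hzc, hxz⟩
            omega
        simp only [hxj, hyj, if_true, if_false] at he
        omega
    · have hyj : ¬ y.val < j := by omega
      simp only [hxj, hyj, if_false] at he
      omega
  · have hne : (d.filter fun y => y ∉ c ∧ y < x).Nonempty := by
      by_contra hempty
      have h := countBelow_add_le_add (c := c) (d := d) (p := 0) (q := x.val) (Nat.zero_le _)
        fun z hz _ hzx => by
          by_contra hzc
          exact hempty ⟨z, Finset.mem_filter.2 ⟨hz, hzc, Fin.lt_def.2 (by omega)⟩⟩
      rw [countBelow_zero, countBelow_zero] at h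
      omega
    obtain ⟨y, hy, hmax⟩ := Finset.exists_max_image _ id hne
    simp only [Finset.mem_filter, id, Fin.lt_def, Fin.le_def] at hy hmax
    refine ⟨y, hy.1, hy.2.1, fun j => ?_⟩
    have he := countBelow_exchange hxc hy.2.1 j
    have hcj := hc j
    have hdj := hd j
    by_cases hyj : y.val < j
    · by_cases hxj : x.val < j
      · simp only [hxj, hyj, if_true] at he
        omega
      · have h := countBelow_add_le_add (c := c) (d := d) (p := j) (q := x.val) (by omega)
          fun z hz hjz hzx => by
            by_contra hzc
            have := hmax z ⟨hz, hzc, hzx⟩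
            omega
        simp only [hxj, hyj, if_true, if_false] at he
        omega
    · have hxj : ¬ x.val < j := by omega
      simp only [hxj, hyj, if_false] at he
      omega

/-- If a base `c` maximizes the total weight, then every base has at most as many elements as `c`
in each superlevel set of the weight. -/
theorem Matroid.card_filter_le_of_isBase_of_forall_sum_le {α : Type*} [DecidableEq α]
    (M : Matroid α) [M.RankFinite] (w : α → ℕ) {c d : Finset α} (hc : M.IsBase c)
    (hd : M.IsBase d) (hmax : ∀ e : Finset α, M.IsBase e → ∑ x ∈ e, w x ≤ ∑ x ∈ c, w x) (j : ℕ) :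
    (d.filter fun x => j ≤ w x).card ≤ (c.filter fun x => j ≤ w x).card := by
  by_contra! hlt
  have hcI : M.Indep (c.filter fun x => j ≤ w x : Finset α) :=
    hc.indep.subset (Finset.coe_subset.2 (Finset.filter_subset _ _))
  have hdI : M.Indep (d.filter fun x => j ≤ w x : Finset α) :=
    hd.indep.subset (Finset.coe_subset.2 (Finset.filter_subset _ _))
  obtain ⟨y, hy, hyI⟩ := hcI.augment_finset hdI hlt
  simp only [Finset.mem_filter] at hy
  have hyc : y ∉ c := by grind
  obtain ⟨B, hB, hIB, hBu⟩ := hyI.2.exists_isBase_subset_union_isBase hc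
  lift B to Finset α using hB.finite
  have hyB : y ∈ B := by simpa using hIB (Set.mem_insert _ _)
  have hBc : B.erase y ⊆ c := by
    intro z hz
    have := hBu (Finset.mem_coe.2 (Finset.mem_of_mem_erase hz))
    simp only [Set.mem_union, Set.mem_insert_iff, Finset.mem_coe, Finset.mem_filter] at this
    grind
  have hcard : B.card = c.card := by
    simpa using hB.ncard_eq_ncard_of_isBase hc
  have hBe := Finset.card_erase_add_one hyB
  obtain ⟨x, hx, hxeq⟩ := (Finset.exists_eq_insert_iff (s := B.erase y) (t := c)).2
    ⟨hBc, by omega⟩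
  have hxj : w x < j := by
    by_contra! h
    have hxc : x ∈ c := hxeq ▸ Finset.mem_insert_self _ _
    have : x ∈ B := by
      simpa using hIB (Set.mem_insert_of_mem _ (by simp [hxc, h]))
    exact hx (Finset.mem_erase.2 ⟨by grind, this⟩)
  have hle := hmax B hB
  rw [← hxeq, Finset.sum_insert hx, ← Finset.add_sum_erase B w hyB] at hle
  omega

theorem countBelow_image_add {n : ℕ} (σ : Equiv.Perm (Fin n)) (c : Finset (Fin n)) (j : ℕ) :
    countBelow (c.image σ) j + (c.filter fun x => j ≤ (σ x).val).card = c.card := by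
  unfold countBelow
  rw [Finset.filter_image, Finset.card_image_of_injective _ σ.injective,
    ← Finset.card_filter_add_card_filter_not (s := c) fun x => (σ x).val < j]
  simp only [not_lt]

/-- A Gale-order interval `[a,b]` of `k`-subsets of `Fin n` is a
matroid: for every permutation `σ`, the interval has a maximum with respect to
the twisted Gale order `s ≤^σ t ↔ σ(s) ≼ σ(t)`. -/
theorem stmt_16 (n : ℕ) (hn : 1 ≤ n) (k : ℕ) (hk1 : 1 ≤ k) (hkn : k ≤ n)
    -- `gale s t` is the Gale order on subsets of `Fin n` (natural order)
    (gale : Finset (Fin n) → Finset (Fin n) → Prop)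
    (hgale : ∀ s t, gale s t ↔
      ∃ φ : {x // x ∈ s} ≃ {x // x ∈ t}, ∀ x, (x.1 : Fin n) ≤ (φ x).1)
    (a b : Finset (Fin n)) (ha : a.card = k) (hb : b.card = k) (hab : gale a b) :
    ∀ σ : Equiv.Perm (Fin n),
      ∃ c, (c.card = k ∧ gale a c ∧ gale c b) ∧
        ∀ d : Finset (Fin n), (d.card = k ∧ gale a d ∧ gale d b) →
          gale (d.image σ) (c.image σ) := by
  intro σ
  simp only [exists_equiv_le_iff_countBelow] at hgale
  let P (c : Finset (Fin n)) : Prop :=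
    c.card = k ∧ ∀ j, countBelow b j ≤ countBelow c j ∧ countBelow c j ≤ countBelow a j
  have hP (c : Finset (Fin n)) : (c.card = k ∧ gale a c ∧ gale c b) ↔ P c := by
    simp only [hgale, P, forall_and]
    grind
  have hPa : P a := ⟨ha, fun j => ⟨((hgale a b).1 hab).2 j, le_rfl⟩⟩
  let M : Matroid (Fin n) := Matroid.ofIsBaseOfFinite Set.finite_univ
    (fun B => ∃ c : Finset (Fin n), (c : Set (Fin n)) = B ∧ P c) ⟨a, a, rfl, hPa⟩
    (by
      rintro _ _ ⟨c, rfl, hc⟩ ⟨d, rfl, hd⟩ x ⟨hxc, hxd⟩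
      obtain ⟨y, hyd, hyc, hy⟩ := exists_exchange_countBelow _ _ (hc.1.trans hd.1.symm) hc.2 hd.2
        (Finset.mem_coe.1 hxc) (fun h => hxd (Finset.mem_coe.2 h))
      refine ⟨y, ⟨hyd, hyc⟩, insert y (c.erase x), by simp, ?_, hy⟩
      rw [Finset.card_insert_of_notMem (by simp [hyc]), Finset.card_erase_add_one hxc, hc.1])
    (by simp)
  have hM (c : Finset (Fin n)) : M.IsBase c ↔ P c := by
    change (∃ e : Finset (Fin n), (e : Set (Fin n)) = c ∧ P e) ↔ P c
    simp
  classical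
  obtain ⟨c, hc, hmax⟩ := Finset.exists_max_image (Finset.univ.filter P)
    (fun c => ∑ x ∈ c, (σ x).val) ⟨a, by simpa using hPa⟩
  simp only [Finset.mem_filter, Finset.mem_univ, true_and] at hc hmax
  refine ⟨c, (hP c).2 hc, fun d hd => ?_⟩
  rw [hP] at hd
  rw [hgale]
  refine ⟨?_, fun j => ?_⟩
  · rw [Finset.card_image_of_injective _ σ.injective, Finset.card_image_of_injective _ σ.injective,
      hc.1, hd.1]
  · have h := M.card_filter_le_of_isBase_of_forall_sum_le (fun x => (σ x).val) ((hM c).2 hc)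
      ((hM d).2 hd) (fun e he => hmax e ((hM e).1 he)) j
    have hcj := countBelow_image_add σ c j
    have hdj := countBelow_image_add σ d j
    have hck := hc.1
    have hdk := hd.1
    omega
end

section
/- Let n ≥ 1, let F be a field, and let a : Fin n → Fin n. Then the following are equivalent: (a) there exists a linearly independent family v_1, …, v_n of vectors in F^n such that for each i, the support {j : v_i(j) ≠ 0} is nonempty and its maximum element equals a(i); (b) there exists a permutation σ of Fin n with σ(i) ≤ a(i) for all i (that is, a is a dual parking function). -/
/-- A square matrix with linearly independent rows has a permutation along which
no entry vanishes. -/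
theorem exists_perm_forall_ne_zero_of_linearIndependent {ι F : Type*} [Fintype ι]
    [DecidableEq ι] [Field F] (M : Matrix ι ι F) (hM : LinearIndependent F M.row) :
    ∃ σ : Equiv.Perm ι, ∀ i, M i (σ i) ≠ 0 := by
  have hdet : M.transpose.det ≠ 0 := by
    rw [Matrix.det_transpose]
    exact ((Matrix.isUnit_iff_isUnit_det M).1
      (Matrix.linearIndependent_rows_iff_isUnit.1 hM)).ne_zero
  rw [Matrix.det_apply] at hdet
  obtain ⟨σ, -, hσ⟩ := Finset.exists_ne_zero_of_sum_ne_zero hdet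
  refine ⟨σ, fun i hi => hσ ?_⟩
  rw [Finset.prod_eq_zero (Finset.mem_univ i) (by simpa using hi), smul_zero]

/-- If `j ≤ b j` for all `j`, the vectors with entry `1` exactly at `j` and `b j`
are linearly independent. -/
theorem linearIndependent_ite_eq_or_eq {ι F : Type*} [Fintype ι] [LinearOrder ι]
    [Field F] (b : ι → ι) (hb : ∀ j, j ≤ b j) :
    LinearIndependent F (fun j k : ι => if k = j ∨ k = b j then (1 : F) else 0) := by
  set M : Matrix ι ι F := Matrix.of fun j k => if k = j ∨ k = b j then 1 else 0 with hM
  have htri : M.BlockTriangular id := by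
    intro j k hkj
    have hkj : k < j := hkj
    simp [hM, hkj.ne, (hkj.trans_le (hb j)).ne]
  have hdet : M.det = 1 := by
    rw [Matrix.det_of_isUpperTriangular htri]
    simp [hM]
  exact Matrix.linearIndependent_rows_iff_isUnit.2
    ((Matrix.isUnit_iff_isUnit_det M).2 (hdet ▸ isUnit_one))

/-- There is a linearly independent family `v_1, …, v_n` in `F^n`
with `max(support v_i) = a(i)` for each `i` iff `a` is a dual parking function,
i.e. there is a permutation `σ` with `σ(i) ≤ a(i)` for all `i`. -/
theorem stmt_17 (n : ℕ) (hn : 1 ≤ n) (F : Type*) [Field F]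
    (a : Fin n → Fin n) :
    (∃ v : Fin n → (Fin n → F), LinearIndependent F v ∧
        ∀ i, v i (a i) ≠ 0 ∧ ∀ j, v i j ≠ 0 → j ≤ a i)
      ↔ (∃ σ : Equiv.Perm (Fin n), ∀ i, σ i ≤ a i) := by
  constructor
  · rintro ⟨v, hv, hsupp⟩
    obtain ⟨σ, hσ⟩ := exists_perm_forall_ne_zero_of_linearIndependent (Matrix.of v) hv
    exact ⟨σ, fun i => (hsupp i).2 _ (hσ i)⟩
  · rintro ⟨σ, hσ⟩
    have hli := (linearIndependent_ite_eq_or_eq (F := F) (fun j => a (σ.symm j))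
      (fun j => by simpa using hσ (σ.symm j))).comp σ σ.injective
    refine ⟨_, hli, fun i => ⟨by simp, fun j hj => ?_⟩⟩
    have hj : j = σ i ∨ j = a i := by simpa [or_iff_not_imp_left] using hj
    rcases hj with rfl | rfl
    · exact hσ i
    · exact le_rfl
end

section
/- Let n ≥ 1. The number of functions a : Fin n → Fin n for which there exists a permutation σ of Fin n with σ(i) ≤ a(i) for all i (i.e. the number of dual parking functions over n) equals (n+1)^{n−1}. -/
open Finset in
/-- Counting characterisation of dual parking functions. -/
theorem exists_perm_le_iff_card_lt_le {n : ℕ} (a : Fin n → Fin n) :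
    (∃ σ : Equiv.Perm (Fin n), ∀ i, σ i ≤ a i) ↔
      ∀ k : ℕ, #{i | (a i : ℕ) < k} ≤ k := by
  constructor
  · rintro ⟨σ, hσ⟩ k
    rw [← card_range k]
    refine card_le_card_of_injOn (fun i => (σ i : ℕ)) ?_ ?_
    · intro i hi
      have h1 : (a i : ℕ) < k := by simpa using hi
      have h2 : (σ i : ℕ) ≤ a i := hσ i
      simpa using lt_of_le_of_lt h2 h1
    · intro i _ j _ hij
      exact σ.injective (Fin.ext hij)
  · intro h
    have hall : ∀ s : Finset (Fin n), #s ≤ #(s.biUnion fun i => Iic (a i)) := by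
      intro s
      rcases s.eq_empty_or_nonempty with rfl | hs
      · simp
      obtain ⟨m, hm, hmax⟩ := s.exists_max_image a hs
      calc #s ≤ #{i | (a i : ℕ) < (a m : ℕ) + 1} := by
            refine card_le_card fun i hi => ?_
            have : (a i : ℕ) ≤ a m := hmax i hi
            simp
            omega
        _ ≤ (a m : ℕ) + 1 := h _
        _ = #(Iic (a m)) := by simp
        _ ≤ _ := card_le_card (subset_biUnion_of_mem (fun i => Iic (a i)) hm)
    obtain ⟨f, hf, hle⟩ := (all_card_le_biUnion_card_iff_exists_injective _).1 hall
    exact ⟨Equiv.ofBijective f (Finite.injective_iff_bijective.1 hf),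
      fun i => by simpa using hle i⟩

/-- The cycle lemma: a walk on `ℕ` that gains `1` over each period `N` has exactly one starting
point per period from which it stays strictly above its initial value. -/
theorem existsUnique_forall_lt_of_add_period {N : ℕ} (hN : 0 < N) (S : ℕ → ℤ)
    (hS : ∀ m, S (m + N) = S m + 1) :
    ∃! r, r < N ∧ ∀ k, 1 ≤ k → k ≤ N → S r < S (r + k) := by
  obtain ⟨r, hr, hmin⟩ := (Finset.range N).exists_min_image
    (fun m => toLex (S m, -(m : ℤ))) ⟨0, by simpa using hN⟩
  simp only [Finset.mem_range, Prod.Lex.toLex_le_toLex] at hr hmin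
  have hgood : ∀ k, 1 ≤ k → k ≤ N → S r < S (r + k) := by
    intro k hk hkN
    by_cases h : r + k < N
    · have := hmin _ h
      push_cast at this
      omega
    · have h1 := hmin (r + k - N) (by omega)
      have h2 := hS (r + k - N)
      rw [Nat.sub_add_cancel (by omega)] at h2
      omega
  have key : ∀ p q, q < N → p < q → (∀ k, 1 ≤ k → k ≤ N → S p < S (p + k)) →
      (∀ k, 1 ≤ k → k ≤ N → S q < S (q + k)) → False := by
    intro p q hq hpq h1 h2
    have h3 := h1 (q - p) (by omega) (by omega)
    have h4 := h2 (p + N - q) (by omega) (by omega)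
    rw [Nat.add_sub_cancel' hpq.le] at h3
    rw [Nat.add_sub_cancel' (by omega), hS] at h4
    omega
  refine ⟨r, ⟨hr, hgood⟩, ?_⟩
  rintro q ⟨hq, hq'⟩
  rcases lt_trichotomy q r with h | h | h
  · exact (key q r hr h hq' hgood).elim
  · exact h
  · exact (key r q hq h hgood hq').elim

open Finset in
/-- A function `b` into `ZMod (n + 1)` is ballot if fewer than `k` of its values are below `k`,
for every `1 ≤ k ≤ n + 1`. -/
def IsBallot {n : ℕ} (b : Fin n → ZMod (n + 1)) : Prop :=
  ∀ k : ℕ, 1 ≤ k → k ≤ n + 1 → #{i | (b i).val < k} < k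

open Finset in
theorem card_val_sub_lt_eq_sum {n N : ℕ} [NeZero N] (f : Fin n → ZMod N) (r : ZMod N) {k : ℕ}
    (hk : k ≤ N) :
    #{i | (f i - r).val < k} = ∑ j ∈ range k, #{i | f i = r + (j : ZMod N)} := by
  rw [card_eq_sum_card_fiberwise (f := fun i => (f i - r).val) (t := range k)]
  · refine sum_congr rfl fun j hj => ?_
    rw [filter_filter]
    congr 1
    ext i
    have hj' : j < k := by simpa using hj
    simp only [mem_filter, mem_univ, true_and]
    constructor
    · rintro ⟨_, h⟩
      rw [← h, ZMod.natCast_zmod_val]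
      ring
    · intro h
      have : (f i - r).val = j := by
        rw [h, add_sub_cancel_left, ZMod.val_cast_of_lt (by omega)]
      omega
  · intro i hi
    simpa using hi

open Finset in
theorem existsUnique_isBallot_sub {n : ℕ} (f : Fin n → ZMod (n + 1)) :
    ∃! r : ZMod (n + 1), IsBallot fun i => f i - r := by
  let T : ℕ → ℕ := fun m => ∑ j ∈ range m, #{i | f i = (j : ZMod (n + 1))}
  have hT : ∀ r k : ℕ, k ≤ n + 1 → T (r + k) = T r + #{i | (f i - (r : ZMod (n + 1))).val < k} := by
    intro r k hk
    rw [card_val_sub_lt_eq_sum f _ hk]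
    simp only [T, sum_range_add, Nat.cast_add]
  have hper : ∀ m, ((m + (n + 1) : ℕ) : ℤ) - T (m + (n + 1)) = ((m : ℤ) - T m) + 1 := by
    intro m
    have : #{i | (f i - (m : ZMod (n + 1))).val < n + 1} = n := by
      rw [filter_true_of_mem fun i _ => ZMod.val_lt _, card_univ, Fintype.card_fin]
    rw [hT m _ le_rfl, this]
    push_cast
    ring
  have hiff : ∀ r : ℕ, IsBallot (fun i => f i - (r : ZMod (n + 1))) ↔
      ∀ k, 1 ≤ k → k ≤ n + 1 → (r : ℤ) - T r < ((r + k : ℕ) : ℤ) - T (r + k) := by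
    intro r
    refine forall_congr' fun k => forall_congr' fun _ => forall_congr' fun hk => ?_
    rw [hT r k hk]
    push_cast
    omega
  obtain ⟨r, ⟨_, hr⟩, huniq⟩ :=
    existsUnique_forall_lt_of_add_period n.succ_pos (fun m => (m : ℤ) - T m) hper
  refine ⟨(r : ZMod (n + 1)), (hiff r).2 hr, fun s hs => ?_⟩
  have hs' : IsBallot fun i => f i - ((s.val : ℕ) : ZMod (n + 1)) := by
    simpa only [ZMod.natCast_zmod_val] using hs
  rw [← huniq s.val ⟨ZMod.val_lt s, (hiff _).1 hs'⟩, ZMod.natCast_zmod_val]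

theorem card_isBallot_mul (n : ℕ) :
    Nat.card {b : Fin n → ZMod (n + 1) // IsBallot b} * (n + 1) = (n + 1) ^ n := by
  have hbij : Function.Bijective
      (fun p : {b : Fin n → ZMod (n + 1) // IsBallot b} × ZMod (n + 1) =>
        fun i => p.1.1 i + p.2) := by
    constructor
    · rintro ⟨⟨b, hb⟩, r⟩ ⟨⟨c, hc⟩, s⟩ h
      have hrs : r = s := by
        refine (existsUnique_isBallot_sub fun i => b i + r).unique ?_ ?_
        · simpa only [add_sub_cancel_right] using hb
        · have h' : (fun i => b i + r) = fun i => c i + s := h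
          simpa only [congrFun h', add_sub_cancel_right] using hc
      subst hrs
      have hbc : b = c := funext fun i => add_right_cancel (congrFun h i)
      subst hbc
      rfl
    · intro f
      obtain ⟨r, hr, -⟩ := existsUnique_isBallot_sub f
      exact ⟨⟨⟨_, hr⟩, r⟩, funext fun i => sub_add_cancel _ _⟩
  have := Nat.card_eq_of_bijective _ hbij
  simpa [Nat.card_prod, Nat.card_fun] using this

open Finset in
theorem card_dualParking_eq_card_isBallot (n : ℕ) :
    Nat.card {a : Fin n → Fin n // ∃ σ : Equiv.Perm (Fin n), ∀ i, σ i ≤ a i}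
      = Nat.card {b : Fin n → ZMod (n + 1) // IsBallot b} := by
  have hval : ∀ x : Fin n, (((x : ℕ) + 1 : ℕ) : ZMod (n + 1)).val = x + 1 := fun x =>
    ZMod.val_cast_of_lt (by omega)
  have hiff : ∀ a : Fin n → Fin n, (∃ σ : Equiv.Perm (Fin n), ∀ i, σ i ≤ a i) ↔
      IsBallot fun i => (((a i : ℕ) + 1 : ℕ) : ZMod (n + 1)) := by
    intro a
    rw [exists_perm_le_iff_card_lt_le]
    simp only [IsBallot, hval]
    constructor
    · intro h k hk _
      obtain ⟨k, rfl⟩ := Nat.exists_eq_add_of_le' hk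
      simpa [Nat.lt_succ_iff] using h k
    · intro h k
      rcases le_or_gt k n with hk | hk
      · simpa [Nat.lt_succ_iff] using h (k + 1) (by omega) (by omega)
      · exact (card_le_univ _).trans (by simpa using hk.le)
  refine Nat.card_eq_of_bijective (fun a => ⟨_, (hiff a.1).1 a.2⟩) ⟨?_, ?_⟩
  · rintro ⟨a, _⟩ ⟨a', _⟩ h
    refine Subtype.ext (funext fun i => Fin.ext ?_)
    have := congrArg ZMod.val (congrFun (congrArg Subtype.val h) i)
    simpa only [hval, Nat.add_right_cancel_iff] using this
  · rintro ⟨b, hb⟩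
    have hpos : ∀ i, 1 ≤ (b i).val := by
      intro i
      by_contra! hi
      have h := hb 1 le_rfl (by omega)
      rw [Nat.lt_one_iff, card_eq_zero] at h
      exact notMem_empty i (h ▸ by simpa using hi)
    have hlt : ∀ i, (b i).val - 1 < n := fun i => by
      have := ZMod.val_lt (b i)
      have := hpos i
      omega
    have heq : (fun i => ((((⟨(b i).val - 1, hlt i⟩ : Fin n) : ℕ) + 1 : ℕ) : ZMod (n + 1))) = b := by
      funext i
      rw [Nat.sub_add_cancel (hpos i), ZMod.natCast_zmod_val]
    exact ⟨⟨fun i => ⟨(b i).val - 1, hlt i⟩, (hiff _).2 ((congrArg IsBallot heq).mpr hb)⟩, Subtype.ext heq⟩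

/-- The number of dual parking functions `a : Fin n → Fin n`
(those admitting a permutation `σ` with `σ(i) ≤ a(i)` for all `i`) is
`(n+1)^{n-1}`. -/
theorem stmt_18 (n : ℕ) (hn : 1 ≤ n) :
    Nat.card {a : Fin n → Fin n // ∃ σ : Equiv.Perm (Fin n), ∀ i, σ i ≤ a i}
      = (n + 1) ^ (n - 1) := by
  rw [card_dualParking_eq_card_isBallot]
  refine Nat.eq_of_mul_eq_mul_right n.succ_pos ?_
  rw [Nat.succ_eq_add_one, card_isBallot_mul, ← pow_succ, Nat.sub_add_cancel hn]
end

section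
/- Let n ≥ 1, F a field, and P ∈ Pos(n). Let V_1, …, V_n be subspaces of F^n such that for every subset I ⊆ Fin n, the dimension of the subspace Σ_{i ∈ I} V_i equals the cardinality of ⋃_{i ∈ I} i↓, where i↓ = {j : j ≤_P i}. Then: (1) for all i, j, V_i ⊆ V_j if and only if i ≤_P j; (2) dim V_i = |i↓| for all i; and (3) Σ_{i ∈ Fin n} V_i = F^n. -/
/-- If subspaces `V_1, …, V_n` of `F^n` satisfy the `P`-flag
dimension condition `dim(Σ_{i∈I} V_i) = |⋃_{i∈I} i↓|` for every `I ⊆ Fin n`,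
then (1) `V_i ⊆ V_j ↔ i ≤_P j`, (2) `dim V_i = |i↓|`, and
(3) `Σ_i V_i = F^n`. -/
theorem stmt_19 (n : ℕ) (hn : 1 ≤ n) (F : Type*) [Field F]
    (leP : Fin n → Fin n → Prop)
    (hPrefl : ∀ i, leP i i) (hPtrans : ∀ i j k, leP i j → leP j k → leP i k)
    (hPnat : ∀ i j, leP i j → i ≤ j)
    (V : Fin n → Submodule F (Fin n → F))
    (hdim : ∀ I : Set (Fin n),
      Module.finrank F ↥(⨆ i ∈ I, V i) = Nat.card {j : Fin n | ∃ i ∈ I, leP j i}) :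
    (∀ i j, V i ≤ V j ↔ leP i j) ∧
    (∀ i, Module.finrank F ↥(V i) = Nat.card {j : Fin n | leP j i}) ∧
    (⨆ i, V i) = ⊤ := by
  simp only [Nat.card_coe_set_eq] at hdim ⊢
  have hone (i : Fin n) : Module.finrank F ↥(V i) = {j : Fin n | leP j i}.ncard := by
    have h := hdim {i}
    rwa [iSup_singleton, show {j : Fin n | ∃ k ∈ ({i} : Set (Fin n)), leP j k} =
      {j | leP j i} by simp] at h
  have hpair (i j : Fin n) : Module.finrank F ↥(V i ⊔ V j) =
      ({k : Fin n | leP k i} ∪ {k | leP k j}).ncard := by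
    have h := hdim {i, j}
    rwa [iSup_pair, show {k : Fin n | ∃ l ∈ ({i, j} : Set (Fin n)), leP k l} =
      {k | leP k i} ∪ {k | leP k j} by ext; simp] at h
  refine ⟨fun i j => ⟨fun hij => ?_, fun hij => ?_⟩, hone, ?_⟩
  · have h := hpair i j
    rw [sup_eq_right.mpr hij, hone j] at h
    have heq : {k : Fin n | leP k j} = {k | leP k i} ∪ {k | leP k j} :=
      Set.eq_of_subset_of_ncard_le Set.subset_union_right h.ge
    have hi : i ∈ {k : Fin n | leP k i} ∪ {k | leP k j} := Or.inl (hPrefl i)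
    rwa [← heq] at hi
  · have h := hpair i j
    have hsub : {k : Fin n | leP k i} ⊆ {k | leP k j} := fun k hk => hPtrans k i j hk hij
    rw [Set.union_eq_self_of_subset_left hsub, ← hone j] at h
    exact sup_eq_right.mp (Submodule.eq_of_le_of_finrank_le le_sup_right h.le).symm
  · have h := hdim Set.univ
    rw [iSup_univ, show {j : Fin n | ∃ i ∈ (Set.univ : Set (Fin n)), leP j i} = Set.univ from
      Set.eq_univ_of_forall fun j => ⟨j, trivial, hPrefl j⟩, Set.ncard_univ, Nat.card_fin] at h
    exact Submodule.eq_top_of_finrank_eq (by simpa using h)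
end
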